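/- Let f(x) = (x² + 1)⁵·(x² + 2) − t·(x² + 3)³·(x³ + x² + 5x + 1), a polynomial of degree 12 in x with coefficients in 𝔽₇(t), the field of rational functions over the finite field 𝔽₇ with generator t. Then the Galois group of (the splitting field of) f over 𝔽₇(t) is a simple group of cardinality 7920 (i.e., it is isomorphic to the Mathieu group M₁₁). -/

import Mathlib

open Polynomial

instance : Fact (Nat.Prime 7) := ⟨by norm_num⟩

/-- The generator `t` of the rational function field `𝔽₇(t)`. -/
noncomputable def t : RatFunc (ZMod 7) := RatFunc.X

/-- `f(x) = (x² + 1)⁵ (x² + 2) − t (x² + 3)³ (x³ + x² + 5x + 1)` over `𝔽₇(t)`. -/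
noncomputable def f : Polynomial (RatFunc (ZMod 7)) :=
  (X ^ 2 + 1) ^ 5 * (X ^ 2 + 2) -
    C t * ((X ^ 2 + 3) ^ 3 * (X ^ 3 + X ^ 2 + 5 * X + 1))

namespace M11
open Finset
set_option linter.unusedSectionVars false
set_option linter.unusedVariables false

section design
variable {Ω : Type*} [Fintype Ω] [DecidableEq Ω]

/-- number of blocks containing `T` -/
def lam (B : Finset (Finset Ω)) (T : Finset Ω) : ℕ := (B.filter (fun b => T ⊆ b)).card

lemma count_global (B : Finset (Finset Ω)) (h6 : ∀ b ∈ B, b.card = 6) (k l : ℕ)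
    (hl : ∀ T : Finset Ω, T.card = k → lam B T = l) (hΩ : Fintype.card Ω = 12) :
    Nat.choose 12 k * l = B.card * Nat.choose 6 k := by
  have h := Finset.sum_card_bipartiteAbove_eq_sum_card_bipartiteBelow
    (fun (T : Finset Ω) (b : Finset Ω) => T ⊆ b) (s := powersetCard k univ) (t := B)
  have h1 : ∀ T ∈ powersetCard k (univ : Finset Ω),
      (bipartiteAbove (fun (T : Finset Ω) (b : Finset Ω) => T ⊆ b) B T).card = l := by
    intro T hT
    exact hl T (mem_powersetCard.1 hT).2
  have h2 : ∀ b ∈ B, (bipartiteBelow (fun (T : Finset Ω) (b : Finset Ω) => T ⊆ b)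
      (powersetCard k univ) b).card = Nat.choose 6 k := by
    intro b hb
    rw [← h6 b hb, ← card_powersetCard]
    congr 1
    ext T
    simp [bipartiteBelow, mem_powersetCard, and_comm]
  rw [sum_congr rfl h1, sum_congr rfl h2] at h
  simpa [hΩ] using h

lemma count_local (B : Finset (Finset Ω)) (c : Finset Ω) (hc : c.card = 6) (k l : ℕ)
    (hl : ∀ T : Finset Ω, T.card = k → lam B T = l) :
    ∑ b ∈ B, Nat.choose (c ∩ b).card k = Nat.choose 6 k * l := by
  have h := Finset.sum_card_bipartiteAbove_eq_sum_card_bipartiteBelow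
    (fun (T : Finset Ω) (b : Finset Ω) => T ⊆ b) (s := powersetCard k c) (t := B)
  have h1 : ∀ T ∈ powersetCard k c,
      (bipartiteAbove (fun (T : Finset Ω) (b : Finset Ω) => T ⊆ b) B T).card = l := by
    intro T hT
    exact hl T (mem_powersetCard.1 hT).2
  have h2 : ∀ b ∈ B, (bipartiteBelow (fun (T : Finset Ω) (b : Finset Ω) => T ⊆ b)
      (powersetCard k c) b).card = Nat.choose (c ∩ b).card k := by
    intro b hb
    rw [← card_powersetCard]
    congr 1
    ext T
    simp only [bipartiteBelow, mem_powersetCard, mem_filter, subset_inter_iff]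
    tauto
  rw [sum_congr rfl h1, sum_congr rfl h2] at h
  rw [← h]; simp [hc]

lemma inter_card (B : Finset (Finset Ω)) (h6 : ∀ b ∈ B, b.card = 6)
    (hB : B.card = 22) (h1 : ∀ T : Finset Ω, T.card = 1 → lam B T = 11)
    (h2 : ∀ T : Finset Ω, T.card = 2 → lam B T = 5)
    (h3 : ∀ T : Finset Ω, T.card = 3 → lam B T = 2) (c : Finset Ω) (hc : c ∈ B) (d : Finset Ω)
    (hd : d ∈ B) (hcd : c ≠ d) : (c ∩ d).card = 0 ∨ (c ∩ d).card = 3 := by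
  have e1 := count_local B c (h6 c hc) 1 11 h1
  have e2 := count_local B c (h6 c hc) 2 5 h2
  have e3 := count_local B c (h6 c hc) 3 2 h3
  have key : ∀ n : ℕ, n ≤ 6 → 6 * Nat.choose n 3 + 4 * Nat.choose n 1 =
      6 * Nat.choose n 2 + n * (n - 3) ^ 2 * (if n ≤ 3 then 0 else 1)
        + n * (3 - n) ^ 2 := by
    intro n hn
    interval_cases n <;> decide
  have hle : ∀ b ∈ B, (c ∩ b).card ≤ 6 := fun b hb => by
    rw [← h6 c hc]; exact card_le_card inter_subset_left
  have e4 : ∑ b ∈ B, (6 * Nat.choose (c ∩ b).card 3 + 4 * Nat.choose (c ∩ b).card 1) =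
     ∑ b ∈ B, (6 * Nat.choose (c ∩ b).card 2 + ((c ∩ b).card * ((c ∩ b).card - 3) ^ 2 *
      (if (c ∩ b).card ≤ 3 then 0 else 1)
        + (c ∩ b).card * (3 - (c ∩ b).card) ^ 2)) :=
    sum_congr rfl (fun b hb => by rw [key _ (hle b hb)]; ring)
  rw [sum_add_distrib, sum_add_distrib, ← mul_sum, ← mul_sum, ← mul_sum, e1, e2, e3] at e4
  rw [← add_sum_erase _ _ hc, ← add_sum_erase _ _ (mem_erase.2 ⟨hcd.symm, hd⟩)] at e4
  have hcc : (c ∩ c).card = 6 := by simp [h6 c hc]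
  rw [hcc] at e4
  have := hle d hd
  generalize (c ∩ d).card = n at *
  interval_cases n <;> simp [Nat.choose] at e4 ⊢ <;> omega

/-- The design properties we use. -/
structure Des (B : Finset (Finset Ω)) : Prop where
  six : ∀ b ∈ B, b.card = 6
  two : ∀ T : Finset Ω, T.card = 3 → lam B T = 2
  int : ∀ c ∈ B, ∀ d ∈ B, c ≠ d → (c ∩ d).card = 0 ∨ (c ∩ d).card = 3

lemma Des.int3 {B : Finset (Finset Ω)} (hB : Des B) {c d : Finset Ω} (hc : c ∈ B) (hd : d ∈ B)
    (hcd : c ≠ d) {x : Ω} (hx : x ∈ c) (hx' : x ∈ d) : (c ∩ d).card = 3 := by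
  rcases hB.int c hc d hd hcd with h | h
  · rw [card_eq_zero] at h
    have : x ∈ c ∩ d := mem_inter.2 ⟨hx, hx'⟩
    rw [h] at this; simp at this
  · exact h

lemma Des.other {B : Finset (Finset Ω)} (hB : Des B) (g : Equiv.Perm Ω)
    (hg : ∀ b ∈ B, b.image g ∈ B) {b : Finset Ω} (hb : b ∈ B) (hgb : b.image g = b)
    (T : Finset Ω) (hT : T.card = 3) (hTb : T ⊆ b) (hTg : ∀ x ∈ T, g x = x) :
    ∃ c ∈ B, c ≠ b ∧ c ∩ b = T ∧ c.image g = c := by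
  have h := hB.two T hT
  rw [lam, card_eq_two] at h
  obtain ⟨x, y, hxy, h⟩ := h
  have hmem : ∀ z, z ∈ B ∧ T ⊆ z ↔ z = x ∨ z = y := by
    intro z
    have : z ∈ B.filter (fun b => T ⊆ b) ↔ z ∈ ({x, y} : Finset (Finset Ω)) := by rw [h]
    simpa using this
  obtain ⟨c, hcb, hc, hall⟩ : ∃ c, c ≠ b ∧ (c ∈ B ∧ T ⊆ c) ∧ ∀ z, z ∈ B ∧ T ⊆ z → z = b ∨ z = c := by
    rcases (hmem b).1 ⟨hb, hTb⟩ with rfl | rfl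
    · exact ⟨y, hxy.symm, (hmem y).2 (Or.inr rfl), fun z hz => (hmem z).1 hz⟩
    · exact ⟨x, hxy, (hmem x).2 (Or.inl rfl), fun z hz => ((hmem z).1 hz).symm⟩
  refine ⟨c, hc.1, hcb, ?_, ?_⟩
  · obtain ⟨x, hx⟩ : T.Nonempty := card_pos.1 (by omega)
    have h3 := hB.int3 hc.1 hb hcb (hc.2 hx) (hTb hx)
    exact (eq_of_subset_of_card_le (subset_inter hc.2 hTb) (by omega)).symm
  · have h1 : T ⊆ c.image g := fun x hx => mem_image.2 ⟨x, hc.2 hx, hTg x hx⟩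
    rcases hall _ ⟨hg c hc.1, h1⟩ with h2 | h2
    · exfalso
      apply hcb
      rw [← hgb] at h2
      exact image_injective g.injective h2
    · exact h2

lemma three_union {U D E F : Finset Ω} (hU : U.card = 6) (hD : D ⊆ U) (hE : E ⊆ U) (hF : F ⊆ U)
    (cD : D.card = 3) (cE : E.card = 3) (cF : F.card = 3) (h1 : (D ∩ E).card = 1)
    (h2 : (D ∩ F).card = 1) (h3 : (E ∩ F).card = 1) {x : Ω} (hx : x ∈ U) :
    x ∈ D ∨ x ∈ E ∨ x ∈ F := by
  have e1 := card_union_add_card_inter D E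
  have e2 := card_union_add_card_inter (D ∪ E) F
  have e3 : (D ∪ E) ∩ F = (D ∩ F) ∪ (E ∩ F) := union_inter_distrib_right D E F
  have e4 := card_union_le (D ∩ F) (E ∩ F)
  rw [e3] at e2
  have : D ∪ E ∪ F = U := by
    apply eq_of_subset_of_card_le
    · exact union_subset (union_subset hD hE) hF
    · omega
  rw [← this] at hx
  simpa [or_assoc] using hx

lemma two_inter (e f : Finset Ω) (p q : Ω) (h : p ≠ q) (hh : ∀ y, y ∈ e ∧ y ∈ f ↔ y = p ∨ y = q) :
    (e ∩ f).card = 2 := by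
  rw [show e ∩ f = {p, q} by ext y; simp [hh]]; exact card_pair h

set_option maxHeartbeats 1000000 in
lemma Des.out_fixed {B : Finset (Finset Ω)} (hB : Des B) (hΩ : Fintype.card Ω = 12)
    (g : Equiv.Perm Ω)
    (hg : ∀ b ∈ B, b.image g ∈ B) {b : Finset Ω} (hb : b ∈ B) {p q r s : Ω}
    (hpq : p ≠ q) (hpr : p ≠ r) (hps : p ≠ s) (hqr : q ≠ r) (hqs : q ≠ s) (hrs : r ≠ s)
    (hp : p ∈ b) (hq : q ∈ b) (hr : r ∈ b) (hs : s ∈ b)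
    (gp : g p = p) (gq : g q = q) (gr : g r = r) (gs : g s = s) :
    (∀ x, x ∉ b → g x = x) ∧ ∃ c ∈ B, c ∩ b = {p, q, r} ∧ c ≠ b := by
  have hgb : b.image g = b := by
    by_contra hne
    have h4 : ({p, q, r, s} : Finset Ω) ⊆ b.image g ∩ b := by
      intro x hx
      simp only [mem_insert, mem_singleton] at hx
      rcases hx with rfl | rfl | rfl | rfl <;> rw [mem_inter, mem_image]
      exacts [⟨⟨_, hp, gp⟩, hp⟩, ⟨⟨_, hq, gq⟩, hq⟩, ⟨⟨_, hr, gr⟩, hr⟩, ⟨⟨_, hs, gs⟩, hs⟩]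
    have := card_le_card h4
    have h5 := hB.int _ (hg b hb) b hb hne
    have : ({p, q, r, s} : Finset Ω).card = 4 := by
      simp [*]
    omega
  have tri : ∀ x y z : Ω, x ≠ y → x ≠ z → y ≠ z → x ∈ b → y ∈ b → z ∈ b → g x = x → g y = y →
      g z = z → ∃ c ∈ B, c ≠ b ∧ c ∩ b = {x, y, z} ∧ c.image g = c := by
    intro x y z h1 h2 h3 hx hy hz gx gy gz
    apply hB.other g hg hb hgb
    · simp [*]
    · intro w hw
      simp only [mem_insert, mem_singleton] at hw
      rcases hw with rfl | rfl | rfl <;> assumption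
    · intro w hw
      simp only [mem_insert, mem_singleton] at hw
      rcases hw with rfl | rfl | rfl <;> assumption
  obtain ⟨c1, k1, n1, i1, g1⟩ := tri p q r hpq hpr hqr hp hq hr gp gq gr
  obtain ⟨c2, k2, n2, i2, g2⟩ := tri p q s hpq hps hqs hp hq hs gp gq gs
  obtain ⟨c3, k3, n3, i3, g3⟩ := tri p r s hpr hps hrs hp hr hs gp gr gs
  obtain ⟨c4, k4, n4, i4, g4⟩ := tri q r s hqr hqs hrs hq hr hs gq gr gs
  have cU : (univ \ b).card = 6 := by
    rw [card_sdiff_of_subset (subset_univ _), card_univ, hΩ, hB.six b hb]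
  have cD : ∀ c ∈ B, (c ∩ b).card = 3 → (c \ b).card = 3 := by
    intro c hc h3
    have := card_sdiff_add_card_inter c b
    have := hB.six c hc
    omega
  have t : ∀ x y z : Ω, x ≠ y → x ≠ z → y ≠ z → ({x, y, z} : Finset Ω).card = 3 := by
    intro x y z h1 h2 h3
    simp [*]
  have pair : ∀ c ∈ B, ∀ d ∈ B, (c ∩ d ∩ b).card = 2 → c ∩ b ≠ d ∩ b →
      ((c \ b) ∩ (d \ b)).card = 1 := by
    intro c hc d hd h2 hne
    have hcd : c ≠ d := by rintro rfl; exact hne rfl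
    obtain ⟨x, hx⟩ : (c ∩ d ∩ b).Nonempty := card_pos.1 (by omega)
    simp only [mem_inter] at hx
    have h3 := hB.int3 hc hd hcd hx.1.1 hx.1.2
    have h4 := card_sdiff_add_card_inter (c ∩ d) b
    have h5 : (c \ b) ∩ (d \ b) = (c ∩ d) \ b := by
      ext y; simp only [mem_inter, mem_sdiff]; tauto
    rw [h5]; omega
  have fixp : ∀ c d : Finset Ω, c.image g = c → d.image g = d → ((c \ b) ∩ (d \ b)).card = 1 →
      ∀ x, x ∈ c → x ∈ d → x ∉ b → g x = x := by
    intro c d hc hd h1 x xc xd xb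
    rw [card_eq_one] at h1
    obtain ⟨y, hy⟩ := h1
    have m : ∀ z, z ∈ c → z ∈ d → z ∉ b → z = y := by
      intro z z1 z2 z3
      have : z ∈ ((c \ b) ∩ (d \ b)) := mem_inter.2 ⟨mem_sdiff.2 ⟨z1, z3⟩, mem_sdiff.2 ⟨z2, z3⟩⟩
      rw [hy] at this; simpa using this
    have gm : ∀ e : Finset Ω, e.image g = e → ∀ z, g z ∈ e ↔ z ∈ e := by
      intro e he z
      conv_lhs => rw [← he]
      simp
    exact (m (g x) ((gm c hc x).2 xc) ((gm d hd x).2 xd)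
      (fun h => xb ((gm b hgb x).1 h))).trans (m x xc xd xb).symm
  have im : ∀ c d : Finset Ω, ∀ e f, c ∩ b = e → d ∩ b = f → c ∩ d ∩ b = e ∩ f := by
    rintro c d e f rfl rfl
    ext y; simp only [mem_inter]; tauto
  have ne3 : ∀ e f : Finset Ω, e.card = 3 → (e ∩ f).card = 2 → e ≠ f := by
    rintro e f h1 h2 rfl
    simp at h2; omega
  have q12 := two_inter {p, q, r} {p, q, s} p q hpq (by clear * - hpq hpr hps hqr hqs hrs; intro y; simp only [mem_insert, mem_singleton]; constructor <;> grind)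
  have q13 := two_inter {p, q, r} {p, r, s} p r hpr (by clear * - hpq hpr hps hqr hqs hrs; intro y; simp only [mem_insert, mem_singleton]; constructor <;> grind)
  have q14 := two_inter {p, q, r} {q, r, s} q r hqr (by clear * - hpq hpr hps hqr hqs hrs; intro y; simp only [mem_insert, mem_singleton]; constructor <;> grind)
  have q23 := two_inter {p, q, s} {p, r, s} p s hps (by clear * - hpq hpr hps hqr hqs hrs; intro y; simp only [mem_insert, mem_singleton]; constructor <;> grind)
  have q24 := two_inter {p, q, s} {q, r, s} q s hqs (by clear * - hpq hpr hps hqr hqs hrs; intro y; simp only [mem_insert, mem_singleton]; constructor <;> grind)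
  have q34 := two_inter {p, r, s} {q, r, s} r s hrs (by clear * - hpq hpr hps hqr hqs hrs; intro y; simp only [mem_insert, mem_singleton]; constructor <;> grind)
  have t1 := t p q r hpq hpr hqr
  have t2 := t p q s hpq hps hqs
  have t3 := t p r s hpr hps hrs
  have t4 := t q r s hqr hqs hrs
  have r12 := pair c1 k1 c2 k2 (by rw [im _ _ _ _ i1 i2, q12]) (by rw [i1, i2]; exact ne3 _ _ t1 q12)
  have r13 := pair c1 k1 c3 k3 (by rw [im _ _ _ _ i1 i3, q13]) (by rw [i1, i3]; exact ne3 _ _ t1 q13)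
  have r14 := pair c1 k1 c4 k4 (by rw [im _ _ _ _ i1 i4, q14]) (by rw [i1, i4]; exact ne3 _ _ t1 q14)
  have r23 := pair c2 k2 c3 k3 (by rw [im _ _ _ _ i2 i3, q23]) (by rw [i2, i3]; exact ne3 _ _ t2 q23)
  have r24 := pair c2 k2 c4 k4 (by rw [im _ _ _ _ i2 i4, q24]) (by rw [i2, i4]; exact ne3 _ _ t2 q24)
  have r34 := pair c3 k3 c4 k4 (by rw [im _ _ _ _ i3 i4, q34]) (by rw [i3, i4]; exact ne3 _ _ t3 q34)
  refine ⟨?_, c1, k1, i1, n1⟩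
  intro x hx
  have d1 := cD c1 k1 (by rw [i1, t1])
  have d2 := cD c2 k2 (by rw [i2, t2])
  have d3 := cD c3 k3 (by rw [i3, t3])
  have d4 := cD c4 k4 (by rw [i4, t4])
  have sU : ∀ c : Finset Ω, c \ b ⊆ univ \ b := fun c => sdiff_subset_sdiff (subset_univ _) (le_refl _)
  have hxU : x ∈ univ \ b := by simp [hx]
  have u1 := three_union cU (sU c1) (sU c2) (sU c3) d1 d2 d3 r12 r13 r23 hxU
  have u2 := three_union cU (sU c1) (sU c2) (sU c4) d1 d2 d4 r12 r14 r24 hxU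
  have u3 := three_union cU (sU c1) (sU c3) (sU c4) d1 d3 d4 r13 r14 r34 hxU
  have u4 := three_union cU (sU c2) (sU c3) (sU c4) d2 d3 d4 r23 r24 r34 hxU
  simp only [mem_sdiff, hx, not_false_eq_true, and_true] at u1 u2 u3 u4
  have f12 := fixp c1 c2 g1 g2 r12 x
  have f13 := fixp c1 c3 g1 g3 r13 x
  have f14 := fixp c1 c4 g1 g4 r14 x
  have f23 := fixp c2 c3 g2 g3 r23 x
  have f24 := fixp c2 c4 g2 g4 r24 x
  have f34 := fixp c3 c4 g3 g4 r34 x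
  clear * - u1 u2 u3 u4 f12 f13 f14 f23 f24 f34 hx
  grind

lemma Des.rigid {B : Finset (Finset Ω)} (hB : Des B) (hΩ : Fintype.card Ω = 12)
    (g : Equiv.Perm Ω)
    (hg : ∀ b ∈ B, b.image g ∈ B) {b : Finset Ω} (hb : b ∈ B) {p q r s : Ω}
    (hpq : p ≠ q) (hpr : p ≠ r) (hps : p ≠ s) (hqr : q ≠ r) (hqs : q ≠ s) (hrs : r ≠ s)
    (hp : p ∈ b) (hq : q ∈ b) (hr : r ∈ b) (hs : s ∈ b)
    (gp : g p = p) (gq : g q = q) (gr : g r = r) (gs : g s = s) : g = 1 := by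
  obtain ⟨h1, c, hc, hcb, hne⟩ := hB.out_fixed hΩ g hg hb hpq hpr hps hqr hqs hrs hp hq hr hs gp gq gr gs
  have mm : ∀ x, x ∈ c ∧ x ∈ b ↔ x = p ∨ x = q ∨ x = r := by
    intro x
    have : x ∈ c ∩ b ↔ x ∈ ({p, q, r} : Finset Ω) := by rw [hcb]
    simpa using this
  obtain ⟨z, hz, hzb⟩ : ∃ z ∈ c, z ∉ b := by
    by_contra hcon
    push Not at hcon
    exact hne (eq_of_subset_of_card_le hcon (by rw [hB.six b hb, hB.six c hc]))
  have hpc := ((mm p).2 (Or.inl rfl)).1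
  have hqc := ((mm q).2 (Or.inr (Or.inl rfl))).1
  have hrc := ((mm r).2 (Or.inr (Or.inr rfl))).1
  obtain ⟨h2, -⟩ := hB.out_fixed hΩ g hg hc hpq hpr (s := z) (by rintro rfl; exact hzb hp) hqr
    (by rintro rfl; exact hzb hq) (by rintro rfl; exact hzb hr) hpc hqc hrc hz gp gq gr (h1 z hzb)
  ext x
  by_cases hxb : x ∈ b
  · by_cases hxc : x ∈ c
    · rcases (mm x).1 ⟨hxc, hxb⟩ with rfl | rfl | rfl <;> simp [*]
    · simpa using h2 x hxc
  · simpa using h1 x hxb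
end design

section grp
variable {G : Type*} [Group G] [Finite G] {Ω : Type*} [Fintype Ω] [DecidableEq Ω] [MulAction G Ω]

lemma fix_mod (p : ℕ) [Fact p.Prime] (g : G) (hg : g ^ p = 1) (S : Finset Ω)
    (hS : ∀ x ∈ S, g • x ∈ S) :
    S.card ≡ (S.filter (fun x => g • x = x)).card [MOD p] := by
  let e : Function.End S := fun x => ⟨g • x.1, hS x.1 x.2⟩
  have hn : ∀ n : ℕ, ∀ x : S, ((e ^ n : Function.End S) x).1 = g ^ n • x.1 := by
    intro n
    induction n with
    | zero => intro x; rw [pow_zero, pow_zero, one_smul]; rfl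
    | succ n ih =>
      intro x
      rw [pow_succ' e, pow_succ', mul_smul, ← ih x]
      rfl
  have he : e ^ p ^ 1 = 1 := by
    funext x
    apply Subtype.ext
    rw [pow_one, hn, hg, one_smul]; rfl
  have := Equiv.Perm.card_fixedPoints_modEq (f := e) he
  rw [Fintype.card_coe] at this
  convert this using 1
  rw [← Set.toFinset_card]
  refine Finset.card_bij' (fun x hx => (⟨x, (mem_filter.1 hx).1⟩ : S)) (fun x _ => x.1) ?_ ?_ ?_ ?_
  · intro x hx
    simp only [Set.mem_toFinset]
    exact Subtype.ext (mem_filter.1 hx).2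
  · intro x hx
    simp only [Set.mem_toFinset] at hx
    exact mem_filter.2 ⟨x.2, congrArg Subtype.val hx⟩
  · intro x hx; rfl
  · intro x hx; rfl

lemma orb (K : Subgroup G) (x : Ω) (S : Finset Ω) (hS : ∀ y, y ∈ S ↔ ∃ g ∈ K, g • x = y) :
    Nat.card K = S.card * Nat.card (K ⊓ MulAction.stabilizer G x : Subgroup G) := by
  have h1 : MulAction.orbit K x = (S : Set Ω) := by
    ext y
    rw [mem_coe, hS, MulAction.mem_orbit_iff]
    constructor
    · rintro ⟨g, hg⟩; exact ⟨g.1, g.2, hg⟩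
    · rintro ⟨g, hg, h⟩; exact ⟨⟨g, hg⟩, h⟩
  have h2 := MulAction.index_stabilizer (G := K) (x := x)
  rw [h1, Set.ncard_coe_finset] at h2
  have h3 := (MulAction.stabilizer K x).card_mul_index
  rw [h2] at h3
  rw [← h3, mul_comm]
  congr 1
  apply Nat.card_congr
  refine ⟨fun g => ⟨g.1.1, g.1.2, g.2⟩, fun g => ⟨⟨g.1, g.2.1⟩, g.2.2⟩, fun _ => rfl, fun _ => rfl⟩

/-- 3-transitivity -/
def T3 (G Ω : Type*) [Group G] [MulAction G Ω] : Prop := ∀ a b c a' b' c' : Ω, a ≠ b → a ≠ c → b ≠ c →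
  a' ≠ b' → a' ≠ c' → b' ≠ c' → ∃ g : G, g • a = a' ∧ g • b = b' ∧ g • c = c'

/-- orbit of `x` under `K` as a finset -/
noncomputable def orbF (K : Subgroup G) (x : Ω) : Finset Ω := by
  classical exact univ.filter (fun y => ∃ g ∈ K, g • x = y)

lemma mem_orbF (K : Subgroup G) (x y : Ω) : y ∈ orbF K x ↔ ∃ g ∈ K, g • x = y := by
  classical simp [orbF]

lemma orbF_smul (K : Subgroup G) (x : Ω) (k : G) (hk : k ∈ K) : ∀ y ∈ orbF K x, k • y ∈ orbF K x := by
  intro y hy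
  rw [mem_orbF] at hy ⊢
  obtain ⟨g, hg, rfl⟩ := hy
  exact ⟨k * g, mul_mem hk hg, mul_smul _ _ _⟩

lemma self_orbF (K : Subgroup G) (x : Ω) : x ∈ orbF K x := by
  rw [mem_orbF]; exact ⟨1, one_mem _, one_smul _ _⟩

lemma T2' (hT : ∀ a b b' : Ω, b ≠ a → b' ≠ a → ∃ g : G, g • a = a ∧ g • b = b')
    (hΩ : Fintype.card Ω = 12)
    (a b a' b' : Ω) (h : a ≠ b) (h' : a' ≠ b') : ∃ g : G, g • a = a' ∧ g • b = b' := by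
  obtain ⟨g1, h1⟩ : ∃ g : G, g • a = a' := by
    by_cases haa : a = a'
    · exact ⟨1, by simp [haa]⟩
    · obtain ⟨x, hx⟩ : ∃ x, x ∉ ({a, a'} : Finset Ω) := by
        by_contra hcon
        push Not at hcon
        have := card_le_card (show (univ : Finset Ω) ⊆ {a, a'} from fun x _ => hcon x)
        have := card_le_two (a := a) (b := a')
        rw [card_univ] at *; omega
      simp only [mem_insert, mem_singleton, not_or] at hx
      obtain ⟨g, _, hg⟩ := hT x a a' (Ne.symm hx.1) (Ne.symm hx.2)
      exact ⟨g, hg⟩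
  obtain ⟨g2, h2, h3⟩ := hT a' (g1 • b) b' (by rw [← h1]; intro hh; exact h (smul_left_cancel g1 hh.symm)) h'.symm
  exact ⟨g2 * g1, by rw [mul_smul, h1, h2], by rw [mul_smul, h3]⟩

lemma conj_fix (g u : G) (x : Ω) : (g * u * g⁻¹) • x = x ↔ u • (g⁻¹ • x) = g⁻¹ • x := by
  rw [mul_smul, mul_smul, ← eq_inv_smul_iff]

lemma T3_of (hΩ : Fintype.card Ω = 12)
    (hT : ∀ a b b' : Ω, b ≠ a → b' ≠ a → ∃ g : G, g • a = a ∧ g • b = b')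
    (u τ : G) (hu : u ^ 5 = 1) (hτ : τ ^ 3 = 1) (y1 y2 : Ω) (hy : y1 ≠ y2)
    (hu' : ∀ x, u • x = x ↔ x = y1 ∨ x = y2) (z1 z2 z3 : Ω) (hz12 : z1 ≠ z2)
    (hτ' : ∀ x, τ • x = x ↔ x = z1 ∨ x = z2 ∨ x = z3) : T3 G Ω := by
  have : Fact (Nat.Prime 5) := ⟨by norm_num⟩
  have : Fact (Nat.Prime 3) := ⟨by norm_num⟩
  have s : ∀ a b d d' : Ω, a ≠ b → d ≠ a → d ≠ b → d' ≠ a → d' ≠ b → 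
      ∃ g : G, g • a = a ∧ g • b = b ∧ g • d = d' := by
    intro a b d d' hab hda hdb hda' hdb'
    set K : Subgroup G := MulAction.stabilizer G a ⊓ MulAction.stabilizer G b with hK
    obtain ⟨g, ga, gb⟩ := T2' hT hΩ y1 y2 a b hy hab
    obtain ⟨k, ka, kb⟩ := T2' hT hΩ z1 z2 a b hz12 hab
    set O := orbF K d with hO
    have h0 : ∀ x ∈ O, x ≠ a ∧ x ≠ b := by
      intro x hmem
      rw [hO, mem_orbF] at hmem
      obtain ⟨g, hg, rfl⟩ := hmem
      have hg1 : g • a = a := hg.1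
      have hg2 : g • b = b := hg.2
      exact ⟨fun h => hda (smul_left_cancel g (h.trans hg1.symm)),
        fun h => hdb (smul_left_cancel g (h.trans hg2.symm))⟩
    have uf : ∀ x, (g * u * g⁻¹) • x = x ↔ x = a ∨ x = b := by
      intro x
      rw [conj_fix, hu', inv_smul_eq_iff, inv_smul_eq_iff, ga, gb]
    have tf : ∀ x, (k * τ * k⁻¹) • x = x ↔ x = a ∨ x = b ∨ x = k • z3 := by
      intro x
      rw [conj_fix, hτ', inv_smul_eq_iff, inv_smul_eq_iff, inv_smul_eq_iff, ka, kb]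
    have h1 := fix_mod 5 (g * u * g⁻¹) (by rw [conj_pow, hu]; simp) O
      (orbF_smul _ _ _ ⟨(uf a).2 (Or.inl rfl), (uf b).2 (Or.inr rfl)⟩)
    have h2 := fix_mod 3 (k * τ * k⁻¹) (by rw [conj_pow, hτ]; simp) O
      (orbF_smul _ _ _ ⟨(tf a).2 (Or.inl rfl), (tf b).2 (Or.inr (Or.inl rfl))⟩)
    have e1 : O.filter (fun x => (g * u * g⁻¹) • x = x) = ∅ := by
      rw [filter_eq_empty_iff]
      intro x hx hxx
      rw [uf] at hxx
      have := h0 x hx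
      tauto
    have e2 : (O.filter (fun x => (k * τ * k⁻¹) • x = x)).card ≤ 1 := by
      rw [← card_singleton (k • z3)]
      apply card_le_card
      intro x hx
      rw [mem_filter, tf] at hx
      have := h0 x hx.1
      rw [mem_singleton]; tauto
    have h3 : 0 < O.card := card_pos.2 ⟨d, self_orbF _ _⟩
    have hsub : O ⊆ (univ.erase a).erase b := by
      intro x hx
      have := h0 x hx
      simp [this]
    have hc10 : ((univ.erase a).erase b : Finset Ω).card = 10 := by
      rw [card_erase_of_mem (by simp [hab.symm]), card_erase_of_mem (mem_univ _), card_univ, hΩ]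
    have h4 : O = (univ.erase a).erase b := by
      apply eq_of_subset_of_card_le hsub
      have := card_le_card hsub
      rw [hc10] at this ⊢
      rw [e1, card_empty] at h1
      simp only [Nat.ModEq] at h1 h2
      generalize (O.filter (fun x => (k * τ * k⁻¹) • x = x)).card = m at *
      omega
    have h5 : d' ∈ O := by rw [h4]; simp [hda', hdb']
    rw [hO, mem_orbF] at h5
    obtain ⟨w, hw, hwd⟩ := h5
    exact ⟨w, hw.1, hw.2, hwd⟩
  intro a b d a' b' d' h1 h2 h3 h4 h5 h6
  obtain ⟨g, ga, gb⟩ := T2' hT hΩ a b a' b' h1 h4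
  obtain ⟨k, ka, kb, kd⟩ := s a' b' (g • d) d' h4 (by rw [← ga]; exact fun h => h2 (smul_left_cancel g h.symm))
     (by rw [← gb]; exact fun h => h3 (smul_left_cancel g h.symm)) h5.symm h6.symm
  exact ⟨k * g, by rw [mul_smul, ga, ka], by rw [mul_smul, gb, kb], by rw [mul_smul, kd]⟩

lemma exists_off (hΩ : Fintype.card Ω = 12) (S : Finset Ω) (hS : S.card < 12) : ∃ x, x ∉ S := by
  by_contra hcon
  push Not at hcon
  have := card_le_card (show (univ : Finset Ω) ⊆ S from fun x _ => hcon x)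
  rw [card_univ] at this; omega

/-- pointwise stabilizers -/
abbrev st (G : Type*) {Ω : Type*} [Group G] [MulAction G Ω] (a : Ω) : Subgroup G := MulAction.stabilizer G a

lemma mem_st (a : Ω) (g : G) : g ∈ st G a ↔ g • a = a := Iff.rfl

lemma smul_ne (g : G) {a x : Ω} (ga : g • a = a) (h : x ≠ a) : g • x ≠ a := by
  intro h'; exact h (smul_left_cancel g (h'.trans ga.symm))

lemma T3.two (hT : T3 G Ω) (hΩ : Fintype.card Ω = 12) (a b a' b' : Ω) (h : a ≠ b) (h' : a' ≠ b') :
    ∃ g : G, g • a = a' ∧ g • b = b' := by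
  obtain ⟨x, hx⟩ := exists_off hΩ {a, b} (lt_of_le_of_lt card_le_two (by norm_num))
  obtain ⟨y, hy⟩ := exists_off hΩ {a', b'} (lt_of_le_of_lt card_le_two (by norm_num))
  simp only [mem_insert, mem_singleton, not_or] at hx hy
  obtain ⟨g, h1, h2, -⟩ := hT a b x a' b' y h (Ne.symm hx.1) (Ne.symm hx.2) h' (Ne.symm hy.1) (Ne.symm hy.2)
  exact ⟨g, h1, h2⟩

lemma T3.one (hT : T3 G Ω) (hΩ : Fintype.card Ω = 12) (a a' : Ω) : ∃ g : G, g • a = a' := by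
  obtain ⟨x, hx⟩ := exists_off hΩ {a} (by simp)
  obtain ⟨y, hy⟩ := exists_off hΩ {a'} (by simp)
  simp only [mem_singleton] at hx hy
  obtain ⟨g, h1, -⟩ := hT.two hΩ a x a' y (Ne.symm hx) (Ne.symm hy)
  exact ⟨g, h1⟩

lemma card1 (hΩ : Fintype.card Ω = 12) (N : Subgroup G) (a : Ω) (h : ∀ x : Ω, ∃ g ∈ N, g • a = x) :
    Nat.card N = 12 * Nat.card (N ⊓ st G a : Subgroup G) := by
  have := orb N a univ (by simpa using h)
  rwa [card_univ, hΩ] at this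

lemma card2 (hΩ : Fintype.card Ω = 12) (N : Subgroup G) (a b : Ω) (hab : b ≠ a)
    (hN : ∀ g ∈ N, g • a = a)
    (h : ∀ x : Ω, x ≠ a → ∃ g ∈ N, g • b = x) :
    Nat.card N = 11 * Nat.card (N ⊓ st G b : Subgroup G) := by
  have := orb N b (univ.erase a) (by
    intro y
    simp only [mem_erase, mem_univ, and_true]
    refine ⟨h y, ?_⟩
    rintro ⟨g, hg, rfl⟩
    exact smul_ne g (hN g hg) hab)
  rwa [card_erase_of_mem (mem_univ _), card_univ, hΩ] at this

lemma card3 (hΩ : Fintype.card Ω = 12) (hT : T3 G Ω) (a b d : Ω) (hab : a ≠ b) (had : a ≠ d)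
    (hbd : b ≠ d) : Nat.card (st G a ⊓ st G b : Subgroup G) = 10 * Nat.card (st G a ⊓ st G b ⊓ st G d : Subgroup G) := by
  have := orb (st G a ⊓ st G b) d ((univ.erase a).erase b) (by
    intro y
    simp only [mem_erase, mem_univ, and_true]
    constructor
    · rintro ⟨h1, h2⟩
      obtain ⟨g, g1, g2, g3⟩ := hT a b d a b y hab had hbd hab h2.symm h1.symm
      exact ⟨g, ⟨g1, g2⟩, g3⟩
    · rintro ⟨g, ⟨hg, hg'⟩, rfl⟩
      exact ⟨smul_ne g hg' hbd.symm, smul_ne g hg had.symm⟩)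
  rwa [card_erase_of_mem (by simp [hab.symm]), card_erase_of_mem (mem_univ _), card_univ, hΩ] at this

lemma cardG (hΩ : Fintype.card Ω = 12) (hT : T3 G Ω) (a b : Ω) (hab : a ≠ b) :
   Nat.card G = 132 * Nat.card (st G a ⊓ st G b : Subgroup G) := by
  have h1 := card1 hΩ (⊤ : Subgroup G) a (fun x => by simpa using hT.one hΩ a x)
  have h2 := card2 hΩ (st G a) a b hab.symm (fun g hg => hg) (fun x hx => by
    obtain ⟨g, hg, hg2⟩ := hT.two hΩ a b a x hab hx.symm
    exact ⟨g, hg, hg2⟩)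
  rw [top_inf_eq, Subgroup.card_top, h2] at h1
  omega

lemma six_dvd (hT : T3 G Ω) (τ ι : G) (hτ : τ ^ 3 = 1) (hτ1 : τ ≠ 1) (hι : ι ^ 2 = 1) (hι1 : ι ≠ 1)
    (z1 z2 z3 : Ω) (hz12 : z1 ≠ z2) (hz13 : z1 ≠ z3) (hz23 : z2 ≠ z3)
    (x1 x2 x3 : Ω) (hx12 : x1 ≠ x2) (hx13 : x1 ≠ x3) (hx23 : x2 ≠ x3)
    (t1 : τ • z1 = z1) (t2 : τ • z2 = z2) (t3 : τ • z3 = z3)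
    (i1 : ι • x1 = x1) (i2 : ι • x2 = x2) (i3 : ι • x3 = x3)
    (N : Subgroup G) [N.Normal] (hτN : τ ∈ N) (hιN : ι ∈ N) (a b d : Ω)
    (hab : a ≠ b) (had : a ≠ d) (hbd : b ≠ d) :
    6 ∣ Nat.card (N ⊓ (st G a ⊓ st G b ⊓ st G d) : Subgroup G) := by
  have key : ∀ g : G, ∀ p : ℕ, p.Prime → g ^ p = 1 → g ≠ 1 → g ∈ N → ∀ w1 w2 w3 : Ω, w1 ≠ w2 → w1 ≠ w3 → w2 ≠ w3 →
      g • w1 = w1 → g • w2 = w2 → g • w3 = w3 →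
      p ∣ Nat.card (N ⊓ (st G a ⊓ st G b ⊓ st G d) : Subgroup G) := by
    intro g p hp hg hg1 hgN w1 w2 w3 h12 h13 h23 g1 g2 g3
    obtain ⟨k, k1, k2, k3⟩ := hT w1 w2 w3 a b d h12 h13 h23 hab had hbd
    have : Fact p.Prime := ⟨hp⟩
    have ho : orderOf (k * g * k⁻¹) = p := by
      apply orderOf_eq_prime
      · rw [conj_pow, hg]; simp
      · simpa [mul_inv_eq_one] using hg1
    rw [← ho]
    apply Subgroup.orderOf_dvd_natCard
    refine ⟨(inferInstance : N.Normal).conj_mem g hgN k, ⟨?_, ?_⟩, ?_⟩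
    · exact (conj_fix _ _ _).2 (by rw [← k1, inv_smul_smul, g1])
    · exact (conj_fix _ _ _).2 (by rw [← k2, inv_smul_smul, g2])
    · exact (conj_fix _ _ _).2 (by rw [← k3, inv_smul_smul, g3])
  have h3 := key τ 3 (by norm_num) hτ hτ1 hτN z1 z2 z3 hz12 hz13 hz23 t1 t2 t3
  have h2 := key ι 2 (by norm_num) hι hι1 hιN x1 x2 x3 hx12 hx13 hx23 i1 i2 i3
  omega

lemma lam_smul (B : Finset (Finset Ω)) (hB : ∀ g : G, ∀ b ∈ B, b.image (g • ·) ∈ B) (T : Finset Ω) (g : G) :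
    lam B T ≤ lam B (T.image (g • ·)) := by
  unfold lam
  apply card_le_card_of_injOn (fun b => b.image (g • ·))
  · intro b hb
    simp only [coe_filter, Set.mem_ofPred_eq] at hb ⊢
    exact ⟨hB g b hb.1, image_subset_image hb.2⟩
  · intro b _ b' _ h
    exact image_injective (MulAction.injective g) h

lemma lam_le (hΩ : Fintype.card Ω = 12) (hT : T3 G Ω) (B : Finset (Finset Ω))
    (hB : ∀ g : G, ∀ b ∈ B, b.image (g • ·) ∈ B) (k : ℕ) (hk : k ≤ 3) (S T : Finset Ω)
    (hS : S.card = k) (hTc : T.card = k) : lam B S ≤ lam B T := by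
  suffices h : ∃ g : G, S.image (g • ·) = T by
    obtain ⟨g, rfl⟩ := h
    exact lam_smul B hB S g
  interval_cases k
  · rw [card_eq_zero] at hS hTc
    subst hS; subst hTc; exact ⟨1, by simp⟩
  · rw [card_eq_one] at hS hTc
    obtain ⟨x, rfl⟩ := hS
    obtain ⟨y, rfl⟩ := hTc
    obtain ⟨g, hg⟩ := hT.one hΩ x y
    exact ⟨g, by simp [hg]⟩
  · rw [card_eq_two] at hS hTc
    obtain ⟨x, x', hx, rfl⟩ := hS
    obtain ⟨y, y', hy, rfl⟩ := hTc
    obtain ⟨g, hg, hg'⟩ := hT.two hΩ x x' y y' hx hy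
    exact ⟨g, by simp [hg, hg', image_insert]⟩
  · rw [card_eq_three] at hS hTc
    obtain ⟨x, x', x'', h1, h2, h3, rfl⟩ := hS
    obtain ⟨y, y', y'', h1', h2', h3', rfl⟩ := hTc
    obtain ⟨g, hg, hg', hg''⟩ := hT x x' x'' y y' y'' h1 h2 h3 h1' h2' h3'
    exact ⟨g, by simp [hg, hg', hg'', image_insert]⟩

lemma des_of (hΩ : Fintype.card Ω = 12) (hT : T3 G Ω) (B : Finset (Finset Ω))
    (hB : ∀ g : G, ∀ b ∈ B, b.image (g • ·) ∈ B) (h6 : ∀ b ∈ B, b.card = 6) (hne : B.Nonempty)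
    (h22 : B.card ≤ 22) : Des B := by
  have hl : ∀ k, k ≤ 3 → ∃ l, ∀ T : Finset Ω, T.card = k → lam B T = l := by
    intro k hk
    obtain ⟨S, -, hS⟩ := exists_subset_card_eq (s := (univ : Finset Ω)) (n := k) (by rw [card_univ]; omega)
    exact ⟨lam B S, fun T hT' => le_antisymm (lam_le hΩ hT B hB k hk T S hT' hS)
      (lam_le hΩ hT B hB k hk S T hS hT')⟩
  obtain ⟨l1, h1⟩ := hl 1 (by norm_num)
  obtain ⟨l2, h2⟩ := hl 2 (by norm_num)
  obtain ⟨l3, h3⟩ := hl 3 (by norm_num)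
  have c1 := count_global B h6 1 l1 h1 hΩ
  have c2 := count_global B h6 2 l2 h2 hΩ
  have c3 := count_global B h6 3 l3 h3 hΩ
  have hpos := card_pos.2 hne
  simp [Nat.choose] at c1 c2 c3
  have e : B.card = 22 := by omega
  have e1 : l1 = 11 := by omega
  have e2 : l2 = 5 := by omega
  have e3 : l3 = 2 := by omega
  subst e1 e2 e3
  exact ⟨h6, h3, fun c hc d hd => inter_card B h6 e h1 h2 h3 c hc d hd⟩

lemma card_le_six [FaithfulSMul G Ω] (hΩ : Fintype.card Ω = 12) (B : Finset (Finset Ω))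
    (hB : ∀ g : G, ∀ b ∈ B, b.image (g • ·) ∈ B) (hD : Des B) (a b d : Ω)
    (hab : a ≠ b) (had : a ≠ d) (hbd : b ≠ d) :
    Nat.card (st G a ⊓ st G b ⊓ st G d : Subgroup G) ≤ 6 := by
  have hT : ({a, b, d} : Finset Ω).card = 3 := card_eq_three.2 ⟨a, b, d, hab, had, hbd, rfl⟩
  have h := hD.two _ hT
  rw [lam, card_eq_two] at h
  obtain ⟨x, y, hxy, h⟩ := h
  have hmem : ∀ z, z ∈ B ∧ {a, b, d} ⊆ z ↔ z = x ∨ z = y := by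
    intro z
    have : z ∈ B.filter (fun b' => {a, b, d} ⊆ b') ↔ z ∈ ({x, y} : Finset (Finset Ω)) := by rw [h]
    simpa using this
  obtain ⟨hx, hx'⟩ := (hmem x).2 (Or.inl rfl)
  obtain ⟨hy, hy'⟩ := (hmem y).2 (Or.inr rfl)
  have ax : a ∈ x := hx' (by simp)
  have bx : b ∈ x := hx' (by simp)
  have dx : d ∈ x := hx' (by simp)
  have ay : a ∈ y := hy' (by simp)
  have h3 := hD.int3 hx hy hxy ax ay
  have hxy3 : x ∩ y = {a, b, d} := (eq_of_subset_of_card_le (subset_inter hx' hy') (by omega)).symm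
  obtain ⟨p, hp, hpy⟩ : ∃ p ∈ x, p ∉ y := by
    by_contra hcon
    push Not at hcon
    exact hxy (eq_of_subset_of_card_le hcon (by rw [hD.six x hx, hD.six y hy]))
  have hcard : ((x ∪ y) \ {a, b, d}).card = 6 := by
    rw [card_sdiff_of_subset (hx'.trans subset_union_left)]
    have := card_union_add_card_inter x y
    rw [hxy3, hT, hD.six x hx, hD.six y hy] at this
    omega
  have htriv : Nat.card (st G a ⊓ st G b ⊓ st G d ⊓ st G p : Subgroup G) = 1 := by
    rw [Subgroup.card_eq_one, eq_bot_iff]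
    rintro g ⟨⟨⟨ga, gb⟩, gd⟩, gp⟩
    rw [Subgroup.mem_bot]
    have hr := hD.rigid hΩ (MulAction.toPerm g) (fun b' hb' => hB g b' hb') hx hab had
      (s := p) (by rintro rfl; exact hpy ay) hbd (by rintro rfl; exact hpy (hy' (by simp)))
      (by rintro rfl; exact hpy (hy' (by simp))) ax bx dx hp ga gb gd gp
    apply FaithfulSMul.eq_of_smul_eq_smul (α := Ω)
    intro w
    rw [one_smul]
    exact congrArg (fun e : Equiv.Perm Ω => e w) hr
  have ho := orb (st G a ⊓ st G b ⊓ st G d) p (orbF (st G a ⊓ st G b ⊓ st G d) p)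
    (fun y => mem_orbF _ _ _)
  rw [htriv, mul_one] at ho
  rw [ho, ← hcard]
  apply card_le_card
  intro w hw
  rw [mem_orbF] at hw
  obtain ⟨g, ⟨⟨ga, gb⟩, gd⟩, rfl⟩ := hw
  have ga : g • a = a := ga
  have gb : g • b = b := gb
  have gd : g • d = d := gd
  have hpa : p ≠ a := by rintro rfl; exact hpy ay
  have hpb : p ≠ b := by rintro rfl; exact hpy (hy' (by simp))
  have hpd : p ≠ d := by rintro rfl; exact hpy (hy' (by simp))
  have him : x.image (g • ·) = x ∨ x.image (g • ·) = y := by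
    apply (hmem _).1
    refine ⟨hB g x hx, ?_⟩
    intro w hw
    simp only [mem_insert, mem_singleton] at hw
    rw [mem_image]
    rcases hw with rfl | rfl | rfl
    exacts [⟨_, ax, ga⟩, ⟨_, bx, gb⟩, ⟨_, dx, gd⟩]
  have hgp : g • p ∈ x.image (g • ·) := mem_image.2 ⟨p, hp, rfl⟩
  simp only [mem_sdiff, mem_union, mem_insert, mem_singleton, not_or]
  refine ⟨?_, smul_ne g ga hpa, smul_ne g gb hpb, smul_ne g gd hpd⟩
  rcases him with h | h
  · rw [h] at hgp; exact Or.inl hgp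
  · rw [h] at hgp; exact Or.inr hgp

lemma pow_gcd_mem (N : Subgroup G) [N.Normal] (g : G) (n : ℕ) (h : g ^ n = 1) :
    g ^ (n.gcd N.index) ∈ N := by
  rw [← QuotientGroup.eq_one_iff, QuotientGroup.mk_pow]
  rw [pow_gcd_eq_one]
  constructor
  · rw [← QuotientGroup.mk_pow, h, QuotientGroup.mk_one]
  · rw [Subgroup.index_eq_card]; exact pow_card_eq_one'

lemma P_trans (hΩ : Fintype.card Ω = 12) (c : G) (hc : c ^ 11 = 1) (a0 : Ω)
    (hca : ∀ x, c • x = x ↔ x = a0) (b b' : Ω) (hb : b ≠ a0) (hb' : b' ≠ a0) :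
    ∃ g ∈ Subgroup.zpowers c, g • b = b' := by
  have : Fact (Nat.Prime 11) := ⟨by norm_num⟩
  set O := orbF (Subgroup.zpowers c) b with hO
  have h1 := fix_mod 11 c hc O (orbF_smul _ _ _ (Subgroup.mem_zpowers c))
  have hle : Subgroup.zpowers c ≤ st G a0 := by
    rw [Subgroup.zpowers_le]; exact (hca a0).2 rfl
  have h0 : a0 ∉ O := by
    intro hmem
    rw [hO, mem_orbF] at hmem
    obtain ⟨g, hg, hgb⟩ := hmem
    exact smul_ne g (hle hg) hb hgb
  have h2 : O.filter (fun x => c • x = x) = ∅ := by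
    rw [filter_eq_empty_iff]
    intro x hx hxx
    rw [hca] at hxx; exact h0 (hxx ▸ hx)
  rw [h2, card_empty] at h1
  have h3 : 0 < O.card := card_pos.2 ⟨b, self_orbF _ _⟩
  have h4 : O = univ.erase a0 := by
    apply eq_of_subset_of_card_le
    · intro x hx; rw [mem_erase]; exact ⟨fun h => h0 (h ▸ hx), mem_univ _⟩
    · rw [card_erase_of_mem (mem_univ _), card_univ, hΩ]
      exact Nat.le_of_dvd h3 ((Nat.modEq_zero_iff_dvd).1 h1)
  have h5 : b' ∈ O := by rw [h4]; simp [hb']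
  rwa [hO, mem_orbF] at h5

lemma T2_of (hΩ : Fintype.card Ω = 12) (c h : G) (hc : c ^ 11 = 1) (a0 : Ω)
    (hca : ∀ x, c • x = x ↔ x = a0) (hh : h • a0 ≠ a0) :
    ∀ a b b' : Ω, b ≠ a → b' ≠ a → ∃ g : G, g • a = a ∧ g • b = b' := by
  have hle : Subgroup.zpowers c ≤ st G a0 := by
    rw [Subgroup.zpowers_le]; exact (hca a0).2 rfl
  have s0 : ∀ b b' : Ω, b ≠ a0 → b' ≠ a0 → ∃ g : G, g • a0 = a0 ∧ g • b = b' := by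
    intro b b' hb hb'
    obtain ⟨g, hg, h⟩ := P_trans hΩ c hc a0 hca b b' hb hb'
    exact ⟨g, hle hg, h⟩
  have s1 : ∀ x : Ω, ∃ g : G, g • a0 = x := by
    intro x
    by_cases hx : x = a0
    · exact ⟨1, by simp [hx]⟩
    · obtain ⟨g, -, hg⟩ := s0 (h • a0) x hh hx
      exact ⟨g * h, by rw [mul_smul, hg]⟩
  intro a b b' hb hb'
  obtain ⟨k, rfl⟩ := s1 a
  have e : ∀ z : Ω, z ≠ k • a0 → k⁻¹ • z ≠ a0 := by
    rintro z hz h; rw [inv_smul_eq_iff] at h; exact hz h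
  obtain ⟨g, hg1, hg2⟩ := s0 (k⁻¹ • b) (k⁻¹ • b') (e b hb) (e b' hb')
  refine ⟨k * g * k⁻¹, ?_, ?_⟩
  · simp [mul_smul, hg1]
  · simp [mul_smul, hg2]

lemma normalizer_no3 [FaithfulSMul G Ω] (hΩ : Fintype.card Ω = 12) (c : G) (hc : c ^ 11 = 1) (a0 : Ω)
    (hca : ∀ x, c • x = x ↔ x = a0) (g : G)
    (hg : g ∈ Subgroup.normalizer ((Subgroup.zpowers c : Subgroup G) : Set G)) (h3 : g ^ 3 = 1) :
    g = 1 := by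
  have : Fact (Nat.Prime 3) := ⟨by norm_num⟩
  rw [Subgroup.mem_normalizer_iff] at hg
  have hle : Subgroup.zpowers c ≤ st G a0 := by
    rw [Subgroup.zpowers_le]; exact (hca a0).2 rfl
  have hga : g • a0 = a0 := by
    have h1 : g * g * c * (g * g)⁻¹ ∈ Subgroup.zpowers c := by
      have := (hg _).1 ((hg c).1 (Subgroup.mem_zpowers c))
      simpa [mul_assoc] using this
    have h2 : (g * g * c * (g * g)⁻¹) • a0 = a0 := hle h1
    rw [conj_fix, hca] at h2
    have h4 : (g * g)⁻¹ = g := by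
      rw [inv_eq_iff_mul_eq_one, ← h3, pow_three']
    rwa [h4] at h2
  have hcomm : ∀ p q : G, p ∈ Subgroup.zpowers c → q ∈ Subgroup.zpowers c → p * q = q * p := by
    rintro p q ⟨i, rfl⟩ ⟨j, rfl⟩
    exact (Commute.refl c).zpow_zpow i j
  have hfree : ∀ p ∈ Subgroup.zpowers c, ∀ b, b ≠ a0 → p • b = b → p = 1 := by
    intro p hp b hb hpb
    apply FaithfulSMul.eq_of_smul_eq_smul (α := Ω)
    intro x
    rw [one_smul]
    by_cases hx : x = a0
    · rw [hx]; exact hle hp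
    · obtain ⟨q, hq, rfl⟩ := P_trans hΩ c hc a0 hca b x hb hx
      rw [← mul_smul, hcomm p q hp hq, mul_smul, hpb]
  have hS := fix_mod 3 g h3 ((univ : Finset Ω).erase a0) (by
    intro x hx
    simp only [mem_erase, mem_univ, and_true] at hx ⊢
    exact smul_ne g hga hx)
  rw [card_erase_of_mem (mem_univ _), card_univ, hΩ] at hS
  have h2 : 1 < (((univ : Finset Ω).erase a0).filter (fun x => g • x = x)).card := by
    simp only [Nat.ModEq] at hS; omega
  rw [one_lt_card] at h2
  obtain ⟨b, hb, d, hd, hbd⟩ := h2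
  simp only [mem_filter, mem_erase, mem_univ, and_true] at hb hd
  obtain ⟨p, hp, hpb⟩ := P_trans hΩ c hc a0 hca b d hb.1 hd.1
  have hp1 : p ≠ 1 := by rintro rfl; rw [one_smul] at hpb; exact hbd hpb
  have hp11 : p ^ 11 = 1 := by
    obtain ⟨i, rfl⟩ := hp
    have : (c ^ i) ^ 11 = (c ^ 11) ^ i := by
      rw [← zpow_natCast, ← zpow_natCast, ← zpow_mul, ← zpow_mul, mul_comm]
    simp only [this, hc, one_zpow]
  have hpa : ∀ x, p • x = x ↔ x = a0 := by
    intro x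
    constructor
    · intro h; by_contra hx; exact hp1 (hfree p hp x hx h)
    · rintro rfl; exact hle hp
  have hgp : g * p * g⁻¹ = p := by
    have hm := (hg p).1 hp
    have hmm : p⁻¹ * (g * p * g⁻¹) ∈ Subgroup.zpowers c := mul_mem (inv_mem hp) hm
    have := hfree _ hmm b hb.1 (by
      rw [mul_smul, mul_smul, mul_smul, inv_smul_eq_iff.2 hb.2.symm, hpb, hd.2, inv_smul_eq_iff, hpb])
    exact (inv_mul_eq_one.1 this).symm
  have hgc : Commute g p := by
    rw [commute_iff_eq]; exact mul_inv_eq_iff_eq_mul.1 hgp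
  apply FaithfulSMul.eq_of_smul_eq_smul (α := Ω)
  intro x
  rw [one_smul]
  by_cases hx : x = a0
  · rw [hx]; exact hga
  · obtain ⟨q, ⟨j, rfl⟩, rfl⟩ := P_trans hΩ p hp11 a0 hpa b x hb.1 hx
    have : g * p ^ j = p ^ j * g := hgc.zpow_right j
    simp only [← mul_smul, this]
    rw [mul_smul, hb.2]

lemma index_no3 [FaithfulSMul G Ω] (hΩ : Fintype.card Ω = 12) (hG : Nat.card G = 7920)
    (c : G) (hc : c ^ 11 = 1) (a0 : Ω)
    (hca : ∀ x, c • x = x ↔ x = a0) (N : Subgroup G) [N.Normal] (hcN : c ∈ N) : ¬ 3 ∣ N.index := by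
  intro h
  have : Fact (Nat.Prime 11) := ⟨by norm_num⟩
  have : Fact (Nat.Prime 3) := ⟨by norm_num⟩
  have hc1 : c ≠ 1 := by
    rintro rfl
    obtain ⟨x, hx⟩ := exists_off hΩ {a0} (by simp)
    apply hx; rw [mem_singleton, ← hca, one_smul]
  have hcard : Nat.card (Subgroup.zpowers c) = 11 ^ (Nat.card G).factorization 11 := by
    rw [Nat.card_zpowers, orderOf_eq_prime hc hc1, hG, show 7920 = 11 ^ 1 * 720 by norm_num,
      Nat.factorization_eq_of_coprime_left]
    · simp [Nat.Prime.factorization_self (show Nat.Prime 11 by norm_num)]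
    · norm_num
    · simp
  have hfr := Sylow.normalizer_sup_eq_top' (N := N) (Sylow.ofCard (Subgroup.zpowers c) hcard)
    (by change Subgroup.zpowers c ≤ N; rwa [Subgroup.zpowers_le])
  set M := Subgroup.normalizer ((Subgroup.zpowers c : Subgroup G) : Set G) with hM
  change M ⊔ N = ⊤ at hfr
  have h1 : N.index = N.relIndex M := by
    rw [← Subgroup.relIndex_top_right, ← hfr, Subgroup.relIndex_sup_right]
  have h2 : 3 ∣ Nat.card M := by
    rw [h1, Subgroup.relIndex] at h
    exact h.trans (Subgroup.index_dvd_card _)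
  obtain ⟨g, hg⟩ := exists_prime_orderOf_dvd_card' 3 h2
  have hg3 : (g : G) ^ 3 = 1 := by
    have := pow_orderOf_eq_one g
    rw [hg] at this
    exact congrArg Subtype.val this
  have := normalizer_no3 hΩ c hc a0 hca g.1 g.2 hg3
  have : g = 1 := Subtype.ext this
  rw [this, orderOf_one] at hg
  omega

lemma conj_fix3 (g τ : G) (z1 z2 z3 : Ω) (hτ' : ∀ x, τ • x = x ↔ x = z1 ∨ x = z2 ∨ x = z3) (x : Ω) :
    (g * τ * g⁻¹) • x = x ↔ x = g • z1 ∨ x = g • z2 ∨ x = g • z3 := by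
  rw [conj_fix, hτ', inv_smul_eq_iff, inv_smul_eq_iff, inv_smul_eq_iff]

lemma exists_moved [FaithfulSMul G Ω] (n : G) (h : n ≠ 1) : ∃ x : Ω, n • x ≠ x := by
  by_contra hcon
  push Not at hcon
  exact h (FaithfulSMul.eq_of_smul_eq_smul (α := Ω) (fun x => by rw [one_smul, hcon]))

lemma N_trans [FaithfulSMul G Ω] (hΩ : Fintype.card Ω = 12) (hT : T3 G Ω) (N : Subgroup G) [hN : N.Normal]
    (n : G) (hnN : n ∈ N) (hn : n ≠ 1) (a b : Ω) : ∃ g ∈ N, g • a = b := by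
  by_cases hab : a = b
  · exact ⟨1, one_mem _, by rw [one_smul, hab]⟩
  obtain ⟨x, hx⟩ := exists_moved (Ω := Ω) n hn
  obtain ⟨g, g1, g2⟩ := hT.two hΩ x (n • x) a b hx.symm hab
  refine ⟨g * n * g⁻¹, hN.conj_mem n hnN g, ?_⟩
  rw [← g1, ← g2]; simp [mul_smul]

lemma N_stab [FaithfulSMul G Ω] (hΩ : Fintype.card Ω = 12) (hT : T3 G Ω) (τ : G)
    (z1 z2 z3 : Ω) (hz12 : z1 ≠ z2) (hz13 : z1 ≠ z3) (hz23 : z2 ≠ z3)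
    (hτ' : ∀ x, τ • x = x ↔ x = z1 ∨ x = z2 ∨ x = z3) (N : Subgroup G) [hN : N.Normal]
    (n : G) (hnN : n ∈ N) (hn : n ≠ 1) (a : Ω) : ∃ g ∈ N, g ≠ 1 ∧ g • a = a := by
  by_contra hcon
  push Not at hcon
  have htr := N_trans hΩ hT N n hnN hn
  have reg : ∀ m ∈ N, ∀ x : Ω, m • x = x → m = 1 := by
    intro m hm x hx
    obtain ⟨g, hg, hga⟩ := htr a x
    by_contra hne
    refine hcon (g⁻¹ * m * g) (by simpa using hN.conj_mem m hm g⁻¹) ?_ ?_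
    · intro h; apply hne
      have : m = g * (g⁻¹ * m * g) * g⁻¹ := by group
      rw [this, h]; simp
    · rw [mul_smul, mul_smul, hga, hx, ← hga, inv_smul_smul]
  obtain ⟨b, hb⟩ := exists_off hΩ {a} (by simp)
  rw [mem_singleton] at hb
  obtain ⟨n1, hn1, e1⟩ := htr a b
  obtain ⟨d, hd⟩ := exists_off hΩ {a, b, n1⁻¹ • a} (lt_of_le_of_lt card_le_three (by norm_num))
  simp only [mem_insert, mem_singleton, not_or] at hd
  obtain ⟨n2, hn2, e2⟩ := htr a d
  obtain ⟨k, k1, k2, k3⟩ := hT z1 z2 z3 a b d hz12 hz13 hz23 (Ne.symm hb) (Ne.symm hd.1) (Ne.symm hd.2.1)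
  set σ := k * τ * k⁻¹ with hσ
  have sf := conj_fix3 k τ z1 z2 z3 hτ'
  rw [← hσ, k1, k2, k3] at sf
  have sa : σ • a = a := (sf a).2 (Or.inl rfl)
  have comm : ∀ m ∈ N, ∀ x : Ω, m • a = x → σ • x = x → σ * m = m * σ := by
    intro m hm x hx sx
    have h1 : m⁻¹ * (σ * m * σ⁻¹) ∈ N := mul_mem (inv_mem hm) (hN.conj_mem m hm σ)
    have h2 := reg _ h1 a (by
      rw [mul_smul, mul_smul, mul_smul, inv_smul_eq_iff.2 sa.symm, hx, sx, inv_smul_eq_iff, hx])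
    have := (inv_mul_eq_one.1 h2)
    exact (eq_mul_inv_iff_mul_eq.1 this).symm
  have c1 := comm n1 hn1 b e1 ((sf b).2 (Or.inr (Or.inl rfl)))
  have hfix : σ • (n1 • d) = n1 • d := by
    rw [← mul_smul, c1, mul_smul, (sf d).2 (Or.inr (Or.inr rfl))]
  rcases (sf _).1 hfix with h | h | h
  · exact hd.2.2 (by rw [← h, inv_smul_smul])
  · exact hd.1 (smul_left_cancel n1 (h.trans e1.symm))
  · have := reg n1 hn1 d h
    rw [this, one_smul] at e1
    exact hb e1.symm

lemma N_top [FaithfulSMul G Ω] (hΩ : Fintype.card Ω = 12) (hG : Nat.card G = 7920) (hT : T3 G Ω)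
    (c h τ : G) (hc : c ^ 11 = 1) (a0 : Ω)
    (hca : ∀ x, c • x = x ↔ x = a0)
    (hh8 : h ^ 8 = 1) (hh4 : h ^ 4 ≠ 1)
    (x1 x2 x3 : Ω) (hx12 : x1 ≠ x2) (hx13 : x1 ≠ x3) (hx23 : x2 ≠ x3)
    (i1 : h ^ 4 • x1 = x1) (i2 : h ^ 4 • x2 = x2) (i3 : h ^ 4 • x3 = x3)
    (hτ : τ ^ 3 = 1) (z1 z2 z3 : Ω) (hz12 : z1 ≠ z2) (hz13 : z1 ≠ z3) (hz23 : z2 ≠ z3)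
    (hτ' : ∀ x, τ • x = x ↔ x = z1 ∨ x = z2 ∨ x = z3) (N : Subgroup G) [hN : N.Normal]
    (n : G) (hnN : n ∈ N) (hn : n ≠ 1) : N = ⊤ := by
  have : Fact (Nat.Prime 3) := ⟨by norm_num⟩
  set a := z1 with ha
  set b := z2 with hb
  set d := z3 with hd
  obtain ⟨m, hm, hm1, hma⟩ := N_stab hΩ hT τ z1 z2 z3 hz12 hz13 hz23 hτ' N n hnN hn a
  have tr1 := N_trans hΩ hT N n hnN hn a
  obtain ⟨x, hx⟩ := exists_moved (Ω := Ω) m hm1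
  have hxa : x ≠ a := by rintro rfl; exact hx hma
  have tr2 : ∀ y : Ω, y ≠ a → ∃ g ∈ N ⊓ st G a, g • b = y := by
    intro y hy
    by_cases hyb : y = b
    · exact ⟨1, one_mem _, by rw [one_smul, hyb]⟩
    obtain ⟨g, g1, g2, g3⟩ := hT a x (m • x) a b y hxa.symm (smul_ne m hma hxa).symm hx.symm hz12 (Ne.symm hy) (Ne.symm hyb)
    refine ⟨g * m * g⁻¹, ⟨hN.conj_mem m hm g, ?_⟩, ?_⟩
    · exact (conj_fix _ _ _).2 (by rw [inv_smul_eq_iff.2 g1.symm, hma])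
    · rw [← g2, ← g3]; simp [mul_smul]
  have k1 := card1 hΩ N a tr1
  have k2 := card2 hΩ (N ⊓ st G a) a b hz12.symm (fun g hg => hg.2) tr2
  have k3 := N.card_mul_index
  rw [hG, k1, k2] at k3
  set K : Subgroup G := N ⊓ st G a ⊓ st G b with hK
  have k4 : Nat.card K * N.index = 60 := by
    have : 132 * (Nat.card K * N.index) = 132 * 60 := by rw [← k3.trans (show 7920 = 132 * 60 by norm_num)]; ring
    omega
  have hdvd : N.index ∣ 60 := Dvd.intro_left _ k4
  have hcN : c ∈ N := by
    have := pow_gcd_mem N c 11 hc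
    have e : Nat.gcd 11 N.index = 1 := Nat.Coprime.coprime_dvd_right hdvd (by norm_num)
    rwa [e, pow_one] at this
  have hιN : h ^ 4 ∈ N := by
    have := pow_gcd_mem N h 8 hh8
    have e : Nat.gcd 8 N.index ∣ 4 := by
      have h1 : Nat.gcd 8 N.index ∣ Nat.gcd 8 60 := Nat.gcd_dvd_gcd_of_dvd_right _ hdvd
      exact h1
    obtain ⟨j, hj⟩ := e
    rw [hj, pow_mul]; exact pow_mem this j
  have hi3 := index_no3 hΩ hG c hc a0 hca N hcN
  have hτN : τ ∈ N := by
    have := pow_gcd_mem N τ 3 hτ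
    have e : Nat.gcd 3 N.index = 1 := (Nat.Prime.coprime_iff_not_dvd (by norm_num)).2 hi3
    rwa [e, pow_one] at this
  have ta : τ • a = a := (hτ' a).2 (Or.inl rfl)
  have tb : τ • b = b := (hτ' b).2 (Or.inr (Or.inl rfl))
  have td : τ • d = d := (hτ' d).2 (Or.inr (Or.inr rfl))
  have hτ1 : τ ≠ 1 := by
    rintro rfl
    obtain ⟨w, hw⟩ := exists_off hΩ {z1, z2, z3} (lt_of_le_of_lt card_le_three (by norm_num))
    apply hw; simp only [mem_insert, mem_singleton]; rw [← hτ', one_smul]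
  have h6 := six_dvd hT τ (h ^ 4) hτ hτ1 (by rw [← pow_mul, hh8]) hh4 z1 z2 z3 hz12 hz13 hz23
    x1 x2 x3 hx12 hx13 hx23 ta tb td i1 i2 i3 N hτN hιN a b d hz12 hz13 hz23
  have hKd : N ⊓ (st G a ⊓ st G b ⊓ st G d) = K ⊓ st G d := by
    simp only [hK, inf_assoc]
  rw [hKd] at h6
  have ho := orb K d (orbF K d) (fun y => mem_orbF _ _ _)
  have hτK : τ ∈ K := ⟨⟨hτN, ta⟩, tb⟩
  have hs := fix_mod 3 τ hτ (orbF K d) (orbF_smul _ _ _ hτK)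
  have hf : (orbF K d).filter (fun x => τ • x = x) = {d} := by
    ext w
    rw [mem_filter, mem_singleton]
    constructor
    · rintro ⟨hw, hw'⟩
      rw [mem_orbF] at hw
      obtain ⟨g, ⟨⟨-, ga⟩, gb⟩, rfl⟩ := hw
      rcases (hτ' _).1 hw' with h | h | h
      · exact absurd h (smul_ne g ga hz13.symm)
      · exact absurd h (smul_ne g gb hz23.symm)
      · exact h
    · rintro rfl; exact ⟨self_orbF _ _, td⟩
  rw [hf, card_singleton] at hs
  obtain ⟨j, hj⟩ := h6
  rw [ho, hj] at k4
  set s := (orbF K d).card with hsdef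
  have hs1 : s * j * N.index = 10 := by
    have : 6 * (s * j * N.index) = 6 * 10 := by rw [← k4.trans (show 60 = 6 * 10 by norm_num)]; ring
    omega
  by_cases hs2 : s = 1
  · exfalso
    rw [hsdef, card_eq_one] at hs2
    obtain ⟨w, hw⟩ := hs2
    have hwd : w = d := by
      have := self_orbF K d
      rw [hw, mem_singleton] at this; exact this.symm
    have fixd : ∀ g ∈ K, g • d = d := by
      intro g hg
      have : g • d ∈ orbF K d := (mem_orbF _ _ _).2 ⟨g, hg, rfl⟩
      rw [hw, mem_singleton, hwd] at this; exact this
    obtain ⟨e, he⟩ := exists_off hΩ {z1, z2, z3} (lt_of_le_of_lt card_le_three (by norm_num))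
    simp only [mem_insert, mem_singleton, not_or] at he
    obtain ⟨g, g1, g2, g3⟩ := hT a b e a b d hz12 (Ne.symm he.1) (Ne.symm he.2.1) hz12 hz13 hz23
    have hgK : g * τ * g⁻¹ ∈ K := by
      refine ⟨⟨hN.conj_mem τ hτN g, ?_⟩, ?_⟩
      · exact (conj_fix _ _ _).2 (by rw [inv_smul_eq_iff.2 g1.symm, ta])
      · exact (conj_fix _ _ _).2 (by rw [inv_smul_eq_iff.2 g2.symm, tb])
    have := fixd _ hgK
    rw [conj_fix, inv_smul_eq_iff.2 g3.symm, hτ'] at this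
    tauto
  · rw [← Subgroup.index_eq_one]
    have hd1 : s ∣ 10 := ⟨j * N.index, by rw [← hs1, mul_assoc]⟩
    have hsle : s ≤ 10 := Nat.le_of_dvd (by norm_num) hd1
    simp only [Nat.ModEq] at hs
    have : s = 10 := by
      clear_value s
      interval_cases s <;> omega
    rw [this] at hs1
    have h7 : j * N.index = 1 := by nlinarith
    exact Nat.dvd_one.1 ⟨j, by rw [mul_comm, h7]⟩

theorem group_main [FaithfulSMul G Ω] (hΩ : Fintype.card Ω = 12)
    (c h u τ : G) (hc : c ^ 11 = 1) (a0 : Ω)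
    (hca : ∀ x, c • x = x ↔ x = a0)
    (hh8 : h ^ 8 = 1) (hh4 : h ^ 4 ≠ 1) (hh0 : ∀ x : Ω, h • x ≠ x)
    (x1 x2 x3 : Ω) (hx12 : x1 ≠ x2) (hx13 : x1 ≠ x3) (hx23 : x2 ≠ x3)
    (i1 : h ^ 4 • x1 = x1) (i2 : h ^ 4 • x2 = x2) (i3 : h ^ 4 • x3 = x3)
    (hu : u ^ 5 = 1) (y1 y2 : Ω) (hy : y1 ≠ y2) (hu' : ∀ x, u • x = x ↔ x = y1 ∨ x = y2)
    (hτ : τ ^ 3 = 1) (z1 z2 z3 : Ω) (hz12 : z1 ≠ z2) (hz13 : z1 ≠ z3) (hz23 : z2 ≠ z3)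
    (hτ' : ∀ x, τ • x = x ↔ x = z1 ∨ x = z2 ∨ x = z3)
    (B : Finset (Finset Ω)) (hB : ∀ g : G, ∀ b ∈ B, b.image (g • ·) ∈ B)
    (h6 : ∀ b ∈ B, b.card = 6) (hne : B.Nonempty) (h22 : B.card ≤ 22) :
    IsSimpleGroup G ∧ Nat.card G = 7920 := by
  have hT2 := T2_of hΩ c h hc a0 hca (hh0 a0)
  have hT := T3_of hΩ hT2 u τ hu hτ y1 y2 hy hu' z1 z2 z3 hz12 hτ'
  have hτ1 : τ ≠ 1 := by
    rintro rfl
    obtain ⟨w, hw⟩ := exists_off hΩ {z1, z2, z3} (lt_of_le_of_lt card_le_three (by norm_num))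
    apply hw; simp only [mem_insert, mem_singleton]; rw [← hτ', one_smul]
  have hG : Nat.card G = 7920 := by
    have e1 := cardG hΩ hT z1 z2 hz12
    have e2 := card3 hΩ hT z1 z2 z3 hz12 hz13 hz23
    have e3 := card_le_six hΩ B hB (des_of hΩ hT B hB h6 hne h22) z1 z2 z3 hz12 hz13 hz23
    have e4 := six_dvd hT τ (h ^ 4) hτ hτ1 (by rw [← pow_mul, hh8]) hh4 z1 z2 z3 hz12 hz13 hz23
      x1 x2 x3 hx12 hx13 hx23 ((hτ' _).2 (by tauto)) ((hτ' _).2 (by tauto)) ((hτ' _).2 (by tauto))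
      i1 i2 i3 ⊤ (Subgroup.mem_top _) (Subgroup.mem_top _) z1 z2 z3 hz12 hz13 hz23
    rw [top_inf_eq] at e4
    have e5 : 0 < Nat.card (st G z1 ⊓ st G z2 ⊓ st G z3 : Subgroup G) := Nat.card_pos
    have e6 := Nat.le_of_dvd e5 e4
    omega
  refine ⟨?_, hG⟩
  have : Nontrivial G := ⟨⟨τ, 1, hτ1⟩⟩
  refine ⟨fun N hN => ?_⟩
  by_cases hN1 : N = ⊥
  · exact Or.inl hN1
  right
  rw [Subgroup.eq_bot_iff_forall] at hN1
  push Not at hN1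
  obtain ⟨n, hnN, hn⟩ := hN1
  exact N_top hΩ hG hT c h τ hc a0 hca hh8 hh4 x1 x2 x3 hx12 hx13 hx23 i1 i2 i3 hτ z1 z2 z3 hz12 hz13 hz23 hτ' N n hnN hn
end grp
section engine
/-- evaluation of a coefficient list (low to high) -/
def ev {A : Type*} [CommRing A] (x : A) : List ℕ → A
  | [] => 0
  | a :: l => (a : A) + x * ev x l

/-- addition -/
def addL : List ℕ → List ℕ → List ℕ
  | [], l => l
  | a :: l, [] => a :: l
  | a :: l, b :: m => ((a + b) % 7) :: addL l m

/-- scaling -/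
def smL (c : ℕ) : List ℕ → List ℕ
  | [] => []
  | a :: l => ((c * a) % 7) :: smL c l

/-- multiplication -/
def mulL : List ℕ → List ℕ → List ℕ
  | [], _ => []
  | a :: l, m => addL (smL a m) (0 :: mulL l m)

/-- normalisation -/
def strip : List ℕ → List ℕ
  | [] => []
  | a :: l => match strip l with
    | [] => if a % 7 = 0 then [] else [a % 7]
    | b :: m => (a % 7) :: b :: m

/-- formal derivative -/
def derL : List ℕ → List ℕ
  | [] => []
  | _ :: l => addL l (0 :: derL l)

/-- last coefficient -/
def lastL : List ℕ → ℕ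
  | [] => 0
  | [a] => a
  | _ :: b :: l => lastL (b :: l)

/-- one reduction step modulo monic `n` -/
def redL (n s : List ℕ) : List ℕ :=
  if s.length = n.length then strip (addL s (smL (7 - lastL s) n)) else s

/-- multiplication modulo monic `n` -/
def mulM (n : List ℕ) : List ℕ → List ℕ → List ℕ
  | [], _ => []
  | a :: l, m => addL (smL a m) (redL n (0 :: mulM n l m))

/-- seventh power modulo `n` -/
def pow7 (n s : List ℕ) : List ℕ :=
  let s2 := mulM n s s
  let s3 := mulM n s2 s
  let s6 := mulM n s3 s3
  mulM n s6 s

/-- iterated Frobenius of `x` modulo `n` -/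
def fr (n : List ℕ) : ℕ → List ℕ
  | 0 => [0, 1]
  | k + 1 => pow7 n (fr n k)

/-- equality as polynomials over the field with seven elements -/
def eqL (a b : List ℕ) : Bool := strip a == strip b

lemma ev_map {A : Type*} [CommRing A] {B : Type*} [CommRing B] (φ : A →+* B) (x : A) (l : List ℕ) : φ (ev x l) = ev (φ x) l := by
  induction l with
  | nil => simp [ev]
  | cons a l ih => simp [ev, ih]

variable {A : Type*} [CommRing A] [CharP A 7]

lemma cast_mod (a : ℕ) : ((a % 7 : ℕ) : A) = a := by
  conv_rhs => rw [← Nat.mod_add_div a 7]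
  rw [Nat.cast_add, Nat.cast_mul, CharP.cast_eq_zero A 7]; simp

lemma ev_addL (x : A) (l m : List ℕ) : ev x (addL l m) = ev x l + ev x m := by
  induction l generalizing m with
  | nil => simp [addL, ev]
  | cons a l ih =>
    cases m with
    | nil => simp [addL, ev]
    | cons b m => simp only [addL, ev, ih, cast_mod, Nat.cast_add]; ring

lemma ev_smL (x : A) (c : ℕ) (l : List ℕ) : ev x (smL c l) = c * ev x l := by
  induction l with
  | nil => simp [smL, ev]
  | cons a l ih => simp only [smL, ev, ih, cast_mod, Nat.cast_mul]; ring

lemma ev_mulL (x : A) (l m : List ℕ) : ev x (mulL l m) = ev x l * ev x m := by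
  induction l with
  | nil => simp [mulL, ev]
  | cons a l ih => simp only [mulL, ev, ev_addL, ev_smL, ih, Nat.cast_zero]; ring

lemma ev_strip (x : A) (l : List ℕ) : ev x (strip l) = ev x l := by
  induction l with
  | nil => simp [strip, ev]
  | cons a l ih =>
    rw [ev, ← ih, strip]
    rcases h : strip l with _ | ⟨b, m⟩
    · simp only [ev]
      split_ifs with h0
      · have := cast_mod (A := A) a
        rw [h0] at this
        simp [ev, ← this]
      · simp [ev, cast_mod]
    · simp only [ev, cast_mod]

lemma ev_eqL (x : A) {a b : List ℕ} (h : eqL a b = true) : ev x a = ev x b := by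
  rw [← ev_strip x a, ← ev_strip x b, eq_of_beq h]

lemma ev_redL (x : A) (n s : List ℕ) (hn : ev x n = 0) : ev x (redL n s) = ev x s := by
  unfold redL
  split_ifs
  · rw [ev_strip, ev_addL, ev_smL, hn]; simp
  · rfl

lemma ev_mulM (x : A) (n : List ℕ) (hn : ev x n = 0) (l m : List ℕ) :
    ev x (mulM n l m) = ev x l * ev x m := by
  induction l with
  | nil => simp [mulM, ev]
  | cons a l ih => simp only [mulM, ev, ev_addL, ev_smL, ev_redL x n _ hn, ih, Nat.cast_zero]; ring

lemma ev_pow7 (x : A) (n : List ℕ) (hn : ev x n = 0) (s : List ℕ) : ev x (pow7 n s) = ev x s ^ 7 := by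
  simp only [pow7, ev_mulM x n hn]; ring

lemma ev_fr (x : A) (n : List ℕ) (hn : ev x n = 0) (k : ℕ) : ev x (fr n k) = x ^ 7 ^ k := by
  induction k with
  | zero => simp [fr, ev]
  | succ k ih => rw [fr, ev_pow7 x n hn, ih, ← pow_mul, pow_succ]

lemma ev_pow (x : A) (l : List ℕ) : ev (x ^ 7) l = (ev x l) ^ 7 := by
  have : Fact (Nat.Prime 7) := ⟨by norm_num⟩
  have : ExpChar A 7 := ExpChar.prime (by norm_num)
  have h := ev_map (frobenius A 7) x l
  rw [frobenius_def, frobenius_def] at h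
  exact h.symm

/-- nonvanishing via Bezout certificate -/
lemma ev_ne [Nontrivial A] (x : A) (n a b : List ℕ) (hn : ev x n = 0) (h : eqL (mulM n a b) [1] = true) :
    ev x a ≠ 0 := by
  intro h0
  have := ev_eqL x h
  rw [ev_mulM x n hn, h0] at this
  simp [ev] at this

open Polynomial in
lemma ev_coeff (l : List ℕ) (i : ℕ) : (ev (X : A[X]) l).coeff i = ((l.getD i 0 : ℕ) : A) := by
  induction l generalizing i with
  | nil => simp [ev]
  | cons a l ih =>
    cases i with
    | zero => simp [ev]
    | succ i => simp [ev, ih, coeff_natCast_ite]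

open Polynomial in
lemma ev_eval (x : A) (l : List ℕ) : (ev (X : A[X]) l).eval x = ev x l := by
  have := ev_map (evalRingHom x) (X : A[X]) l
  simpa using this

open Polynomial in
lemma ev_der (l : List ℕ) : derivative (ev (X : A[X]) l) = ev (X : A[X]) (derL l) := by
  induction l with
  | nil => simp [ev, derL]
  | cons a l ih => simp [ev, derL, ev_addL, ih]

open Polynomial in
lemma ev_natDegree (l : List ℕ) : (ev (X : A[X]) l).natDegree ≤ l.length - 1 := by
  rw [natDegree_le_iff_coeff_eq_zero]
  intro N hN
  rw [ev_coeff, List.getD_eq_default _ _ (by omega)]; simp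

open Polynomial in
lemma ev_ne_zero (l : List ℕ) (i : ℕ) (h : ((l.getD i 0 : ℕ) : A) ≠ 0) : ev (X : A[X]) l ≠ 0 := by
  intro h0
  have := ev_coeff (A := A) l i
  rw [h0] at this
  exact h (by simpa using this.symm)

open Polynomial in
lemma card_roots_le [IsDomain A] (l : List ℕ) (i : ℕ) (h : l.getD i 0 = 1) (S : Finset A)
    (hS : ∀ x ∈ S, ev x l = 0) : S.card ≤ l.length - 1 := by
  classical
  have h0 : ev (X : A[X]) l ≠ 0 := ev_ne_zero l i (by rw [h]; simp)
  have h1 : S ⊆ (ev (X : A[X]) l).roots.toFinset := by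
    intro x hx
    rw [Multiset.mem_toFinset, mem_roots h0, IsRoot, ev_eval]
    exact hS x hx
  calc S.card ≤ _ := Finset.card_le_card h1
    _ ≤ _ := Multiset.toFinset_card_le _
    _ ≤ _ := card_roots' _
    _ ≤ _ := ev_natDegree l
end engine
section place
open Polynomial

lemma frob_place {L : Type} [Field L] [Algebra (RatFunc (ZMod 7)) L] [Algebra (ZMod 7)[X] L]
    [IsScalarTower (ZMod 7)[X] (RatFunc (ZMod 7)) L]
    [FiniteDimensional (RatFunc (ZMod 7)) L] [IsGalois (RatFunc (ZMod 7)) L]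
    (p : (ZMod 7)[X]) (hp : Irreducible p) (hm : p.Monic) :
    ∃ (k : Type) (_ : Field k) (_ : CharP k 7) (φ : integralClosure (ZMod 7)[X] L →+* k)
      (g : L ≃ₐ[RatFunc (ZMod 7)] L),
      φ (algebraMap (ZMod 7)[X] (integralClosure (ZMod 7)[X] L) p) = 0 ∧
      ∀ x y : integralClosure (ZMod 7)[X] L, (y : L) = g x → φ y = φ x ^ 7 ^ p.natDegree := by
  let R := (ZMod 7)[X]
  let K := RatFunc (ZMod 7)
  let S := integralClosure R L
  have : IsFractionRing S L := integralClosure.isFractionRing_of_finite_extension K L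
  have : Module.Finite R S := IsIntegralClosure.finite R K L S
  have hP : (Ideal.span {p} : Ideal R).IsMaximal := PrincipalIdealRing.isMaximal_of_irreducible hp
  have hinj : Function.Injective (algebraMap R S) := by
    have h1 : Function.Injective (algebraMap R L) := by
      rw [IsScalarTower.algebraMap_eq R K L]
      exact (algebraMap K L).injective.comp (IsFractionRing.injective R K)
    rw [IsScalarTower.algebraMap_eq R S L, RingHom.coe_comp] at h1
    exact Function.Injective.of_comp h1
  obtain ⟨Q, hQ, hQP⟩ := Ideal.exists_ideal_over_maximal_of_isIntegral (S := S) (Ideal.span {p} : Ideal R)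
    (by rw [(RingHom.injective_iff_ker_eq_bot _).1 hinj]; exact bot_le)
  have hcard : Nat.card (R ⧸ (Ideal.span {p} : Ideal R)) = 7 ^ p.natDegree := by
    have b := (AdjoinRoot.powerBasis' hm)
    have h1 : Nat.card (AdjoinRoot p) = 7 ^ p.natDegree := by
      have : Module.Finite (ZMod 7) (AdjoinRoot p) := (AdjoinRoot.powerBasis' hm).finite
      rw [Module.natCard_eq_pow_finrank (K := ZMod 7), (AdjoinRoot.powerBasis' hm).finrank]
      simp
    exact h1
  have hfin : Finite (S ⧸ Q) := by
    have : Finite (R ⧸ Q.comap (algebraMap R S)) := by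
      rw [hQP]
      exact Nat.finite_of_card_ne_zero (by rw [hcard]; positivity)
    have : Module.Finite (R ⧸ Q.comap (algebraMap R S)) (S ⧸ Q) := by
      infer_instance
    exact Module.finite_of_finite (R ⧸ Q.comap (algebraMap R S))
  have := Algebra.isInvariant_of_isGalois' R K L S
  have : Finite (S ≃ₐ[R] S) := Finite.of_equiv _ (galRestrict R K L S).toEquiv
  obtain ⟨σ, hσ⟩ := IsArithFrobAt.exists_of_isInvariant R (S ≃ₐ[R] S) Q
  let g := (galRestrict R K L S).symm σ
  refine ⟨S ⧸ Q, Ideal.Quotient.field Q, ?_, Ideal.Quotient.mk Q, g, ?_, ?_⟩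
  · let _ := Ideal.Quotient.field Q
    exact charP_of_injective_ringHom ((Ideal.Quotient.mk Q).comp ((algebraMap R S).comp (C : ZMod 7 →+* R))).injective 7
  · rw [Ideal.Quotient.eq_zero_iff_mem]
    change p ∈ Q.comap (algebraMap R S)
    rw [hQP]
    exact Ideal.mem_span_singleton_self p
  · intro x y hxy
    have h1 : y = σ x := by
      apply Subtype.ext
      rw [hxy]
      have := algebraMap_galRestrict_apply R (K := K) (L := L) (B := S) g x
      simp only [g, MulEquiv.apply_symm_apply] at this
      exact this.symm
    have h2 := hσ x
    have h3 : Q.under R = Ideal.span {p} := hQP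
    rw [h3, hcard] at h2
    rw [h1, ← map_pow, Ideal.Quotient.mk_eq_mk_iff_sub_mem]
    exact h2
end place
section poly
open Polynomial

/-- numerator -/
def F1L : List ℕ := [2, 0, 11, 0, 25, 0, 30, 0, 20, 0, 7, 0, 1]
/-- denominator -/
def F2L : List ℕ := [27, 135, 54, 162, 36, 72, 10, 14, 1, 1]
/-- Wronskian -/
def WrL : List ℕ := [3, 0, 2, 4, 0, 5, 0, 5, 1, 3, 6, 3, 3, 5, 3, 1, 1, 4, 0, 4, 3]

/-- the polynomial with parameter -/
noncomputable def fS {A : Type*} [CommRing A] (θ : A) : A[X] := ev X F1L - C θ * ev X F2L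

lemma f_eq : f = fS t := by
  unfold f fS
  congr 1
  · simp only [ev, F1L]; push_cast; ring
  · congr 1
    simp only [ev, F2L]; push_cast; ring

lemma fS_map {A B : Type*} [CommRing A] [CommRing B] (φ : A →+* B) (θ : A) :
    (fS θ).map φ = fS (φ θ) := by
  have h := fun l => ev_map (mapRingHom φ) (X : A[X]) l
  simp only [coe_mapRingHom, map_X] at h
  simp only [fS, Polynomial.map_sub, Polynomial.map_mul, map_C, h]

variable {k : Type*} [CommRing k] [Nontrivial k] [CharP k 7]

lemma fS_eval (θ x : k) : (fS θ).eval x = ev x F1L - θ * ev x F2L := by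
  simp [fS, ev_eval]

lemma fS_coeff (θ : k) (i : ℕ) :
    (fS θ).coeff i = ((F1L.getD i 0 : ℕ) : k) - θ * ((F2L.getD i 0 : ℕ) : k) := by
  rw [fS, coeff_sub, coeff_C_mul, ev_coeff, ev_coeff]

lemma fS_natDegree_le (θ : k) : (fS θ).natDegree ≤ 12 := by
  rw [natDegree_le_iff_coeff_eq_zero]
  intro N hN
  rw [fS_coeff, List.getD_eq_default _ _ (by simp [F1L]; omega), List.getD_eq_default _ _ (by simp [F2L]; omega)]
  simp

lemma fS_monic (θ : k) : (fS θ).Monic := by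
  apply monic_of_natDegree_le_of_coeff_eq_one 12 (fS_natDegree_le θ)
  rw [fS_coeff]
  simp [F1L, F2L]

lemma fS_natDegree (θ : k) : (fS θ).natDegree = 12 := by
  apply natDegree_eq_of_le_of_coeff_ne_zero (fS_natDegree_le θ)
  rw [fS_coeff]
  simp [F1L, F2L]

end poly

section polyfield
open Polynomial
variable {k : Type*} [Field k] [CharP k 7]

lemma F2_ne (θ x : k) (h : (fS θ).eval x = 0) : ev x F2L ≠ 0 := by
  intro h2
  rw [fS_eval, h2, mul_zero, sub_zero] at h
  exact ev_ne x F1L F2L [2, 5, 2, 6, 2, 5, 2, 5, 0, 3, 0, 4] h (by decide +kernel) h2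

lemma wr_zero (θ x : k) (h : (fS θ).eval x = 0) (h' : (derivative (fS θ)).eval x = 0) :
    ev x WrL = 0 := by
  have e : eqL WrL (addL (mulL (derL F1L) F2L) (smL 6 (mulL F1L (derL F2L)))) = true := by decide +kernel
  rw [ev_eqL x e, ev_addL, ev_smL, ev_mulL, ev_mulL]
  rw [fS_eval] at h
  simp only [fS, derivative_sub, derivative_mul, derivative_C, ev_der, eval_sub, eval_mul,
    eval_C, ev_eval, zero_mul, zero_add] at h'
  have h7 : (7 : k) = 0 := by exact_mod_cast CharP.cast_eq_zero k 7
  push_cast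
  linear_combination ev x F2L * h' - ev x (derL F2L) * h + ev x F1L * ev x (derL F2L) * h7

lemma double_root (θ x : k) (h : (X - C x) ^ 2 ∣ fS θ) : ev x WrL = 0 := by
  obtain ⟨q, hq⟩ := h
  apply wr_zero θ x
  · rw [hq]; simp
  · rw [hq]; simp [derivative_mul, derivative_pow]
end polyfield

section trans
open Polynomial
variable {M : Type*} [Field M] [Algebra (ZMod 7) M] [Algebra (RatFunc (ZMod 7)) M]
  [IsScalarTower (ZMod 7) (RatFunc (ZMod 7)) M]

lemma t_trans : ¬ IsAlgebraic (ZMod 7) (algebraMap (RatFunc (ZMod 7)) M t) := by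
  rw [isAlgebraic_algebraMap_iff (algebraMap (RatFunc (ZMod 7)) M).injective]
  have h := RatFunc.transcendental_of_ne_C (K := ZMod 7) t ?_
  · exact h
  · rintro ⟨c, hc⟩
    have h1 : algebraMap (ZMod 7)[X] (RatFunc (ZMod 7)) X = algebraMap (ZMod 7)[X] (RatFunc (ZMod 7)) (C c) := by
      rw [RatFunc.algebraMap_X, RatFunc.algebraMap_C]; exact hc
    have h2 := IsFractionRing.injective (ZMod 7)[X] (RatFunc (ZMod 7)) h1
    have := congrArg (fun p => coeff p 1) h2
    simp at this

lemma ev_alg {x : M} (hx : IsAlgebraic (ZMod 7) x) (l : List ℕ) : IsAlgebraic (ZMod 7) (ev x l) := by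
  induction l with
  | nil => simp only [ev]; exact isAlgebraic_zero
  | cons a l ih => simp only [ev]; exact (isAlgebraic_natCast a).add (hx.mul ih)

lemma alg_of_ev {x : M} {l : List ℕ} (i : ℕ) (hi : ((l.getD i 0 : ℕ) : ZMod 7) ≠ 0) (h : ev x l = 0) :
    IsAlgebraic (ZMod 7) x := by
  refine ⟨ev X l, ev_ne_zero l i hi, ?_⟩
  have := ev_map (aeval x : (ZMod 7)[X] →ₐ[ZMod 7] M).toRingHom (X : (ZMod 7)[X]) l
  simpa [h] using this

lemma f_sep : f.Separable := by
  refine (isCoprime_iff_aeval_ne_zero_of_isAlgClosed (RatFunc (ZMod 7)) (AlgebraicClosure (RatFunc (ZMod 7))) _ _).2 ?_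
  intro a
  by_contra! hcon
  obtain ⟨h1, h2⟩ := hcon
  have : CharP (AlgebraicClosure (RatFunc (ZMod 7))) 7 := by
    exact charP_of_injective_algebraMap (algebraMap (ZMod 7) _).injective 7
  rw [aeval_def, ← eval_map, f_eq, fS_map] at h1
  rw [aeval_def, ← eval_map, ← derivative_map, f_eq, fS_map] at h2
  have h3 := wr_zero _ a h1 h2
  have h4 := F2_ne _ a h1
  have h5 : IsAlgebraic (ZMod 7) a := alg_of_ev 0 (by decide) h3
  apply t_trans (M := AlgebraicClosure (RatFunc (ZMod 7)))
  rw [fS_eval, sub_eq_zero] at h1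
  rw [← div_eq_iff h4] at h1
  rw [← h1, div_eq_mul_inv]
  exact (ev_alg h5 _).mul (ev_alg h5 _).inv
end trans
section roots
open Polynomial

/-- the roots -/
abbrev Om : Type := ↥(f.rootSet f.SplittingField)

lemma Om_card : Fintype.card Om = 12 := by
  rw [card_rootSet_eq_natDegree f_sep (SplittingField.splits f), f_eq, fS_natDegree]

lemma Om_smul (g : f.Gal) (x : Om) : ((g • x : Om) : f.SplittingField) = g (x : f.SplittingField) := rfl

instance : FaithfulSMul f.Gal Om where
  eq_of_smul_eq_smul := by
    intro a b h
    apply Polynomial.Gal.ext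
    intro x hx
    have := congrArg (fun y : Om => (y : f.SplittingField)) (h ⟨x, hx⟩)
    exact this

instance : IsGalois (RatFunc (ZMod 7)) f.SplittingField := IsGalois.of_separable_splitting_field f_sep

lemma f_prod : f.map (algebraMap _ f.SplittingField) = ∏ x : Om, (X - C (x : f.SplittingField)) := by
  classical
  have hm : (f.map (algebraMap _ f.SplittingField)).Monic := by rw [f_eq]; exact (fS_monic t).map _
  have h := (SplittingField.splits f).eq_prod_roots_of_monic hm
  rw [h]
  have hn : (f.map (algebraMap _ f.SplittingField)).roots.Nodup := nodup_roots (f_sep.map)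
  have h2 : (f.map (algebraMap _ f.SplittingField)).roots = (f.map (algebraMap _ f.SplittingField)).roots.toFinset.val := by
    rw [Multiset.toFinset_val, hn.dedup]
  rw [h2, Finset.prod_map_val]
  apply Finset.prod_subtype
  intro x
  rw [Multiset.mem_toFinset, mem_rootSet', mem_roots', IsRoot, eval_map, aeval_def]

lemma place (pl : List ℕ) (hi : Irreducible (ev (X : (ZMod 7)[X]) pl)) (hm : (ev (X : (ZMod 7)[X]) pl).Monic)
    (d : ℕ) (hd : (ev (X : (ZMod 7)[X]) pl).natDegree = d) :
    ∃ (k : Type) (_ : Field k) (_ : CharP k 7) (θ : k) (r : Om → k) (g : f.Gal), ev θ pl = 0 ∧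
      (∀ x, r (g • x) = r x ^ 7 ^ d) ∧ fS θ = ∏ x : Om, (X - C (r x)) := by
  obtain ⟨k, _, _, φ, g, h1, h2⟩ := frob_place (L := f.SplittingField) _ hi hm
  rw [hd] at h2
  let R := (ZMod 7)[X]
  let S := integralClosure R f.SplittingField
  have ht : algebraMap R f.SplittingField X = algebraMap (RatFunc (ZMod 7)) f.SplittingField t := by
    rw [IsScalarTower.algebraMap_apply R (RatFunc (ZMod 7)) f.SplittingField, RatFunc.algebraMap_X]; rfl
  have hint : ∀ x : Om, IsIntegral R (x : f.SplittingField) := by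
    intro x
    refine ⟨fS (X : R), fS_monic _, ?_⟩
    rw [← eval_map, fS_map, ht, ← fS_map, ← f_eq, eval_map, ← aeval_def]
    exact aeval_eq_zero_of_mem_rootSet x.2
  let s : Om → S := fun x => ⟨x, hint x⟩
  refine ⟨k, inferInstance, inferInstance, φ (algebraMap R S X), fun x => φ (s x), g, ?_, ?_, ?_⟩
  · rw [← h1, ev_map (algebraMap R S), ev_map φ]
  · intro x
    exact h2 _ _ rfl
  · have h3 : fS (algebraMap R S X) = ∏ x : Om, (X - C (s x)) := by
      apply Polynomial.map_injective (algebraMap S f.SplittingField) Subtype.val_injective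
      rw [fS_map, ← IsScalarTower.algebraMap_apply, ht, ← fS_map, ← f_eq, f_prod, Polynomial.map_prod]
      apply Finset.prod_congr rfl
      intro x _
      simp only [Polynomial.map_sub, map_X, map_C]
      rfl
    rw [← fS_map, h3, Polynomial.map_prod]
    simp

lemma place_root {k : Type} [Field k] {θ : k} {r : Om → k} (h : fS θ = ∏ x : Om, (X - C (r x))) (x : Om) :
    (fS θ).eval (r x) = 0 := by
  rw [h, eval_prod]
  exact Finset.prod_eq_zero (Finset.mem_univ x) (by simp)

lemma place_inj {k : Type} [Field k] [CharP k 7] {θ : k} {r : Om → k}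
    (h : fS θ = ∏ x : Om, (X - C (r x)))
    (hw : ∀ x, ev (r x) WrL ≠ 0) : Function.Injective r := by
  classical
  intro x y hxy
  by_contra hne
  apply hw x
  apply double_root θ
  rw [h, ← Finset.mul_prod_erase _ _ (Finset.mem_univ x),
    ← Finset.mul_prod_erase _ _ (Finset.mem_erase.2 ⟨Ne.symm hne, Finset.mem_univ y⟩), ← hxy, ← mul_assoc, ← pow_two]
  exact dvd_mul_right _ _

lemma place_pow {k : Type} [Field k] {r : Om → k} {g : f.Gal} {d : ℕ}
    (h : ∀ x, r (g • x) = r x ^ 7 ^ d) (m : ℕ) (x : Om) : r (g ^ m • x) = r x ^ 7 ^ (d * m) := by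
  induction m with
  | zero => simp
  | succ m ih => rw [pow_succ', mul_smul, h, ih, ← pow_mul, ← pow_add]; ring_nf

lemma gal_eq_one {g : f.Gal} (h : ∀ x : Om, g • x = x) : g = 1 :=
  FaithfulSMul.eq_of_smul_eq_smul (α := Om) (fun x => by rw [h x, one_smul])

section num
variable {k : Type} [Field k] [CharP k 7]

lemma pw_eq {x : k} {n : List ℕ} {m : ℕ} (hn : ev x n = 0) (h : eqL (fr n m) [0, 1] = true) : x ^ 7 ^ m = x := by
  rw [← ev_fr x n hn, ev_eqL x h]; simp [ev]

lemma pw_ne {x : k} {n : List ℕ} {m : ℕ} (b : List ℕ) (hn : ev x n = 0)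
    (h : eqL (mulM n (addL (fr n m) [0, 6]) b) [1] = true) : x ^ 7 ^ m ≠ x := by
  intro h0
  apply ev_ne x n _ b hn h
  rw [ev_addL, ev_fr x n hn, h0]
  have h7 : (7 : k) = 0 := by exact_mod_cast CharP.cast_eq_zero k 7
  simp only [ev]; push_cast
  linear_combination x * h7

lemma norm1 {θ x : k} (a : ℕ) (hθ : ev θ [a, 1] = 0) (h : (fS θ).eval x = 0) :
    ev x (addL (smL a F2L) F1L) = 0 := by
  rw [ev_addL, ev_smL]
  rw [fS_eval] at h
  simp only [ev] at hθ
  push_cast at hθ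
  linear_combination h + ev x F2L * hθ

lemma norm2 {θ x : k} (a b : ℕ) (hθ : ev θ [a, b, 1] = 0) (h : (fS θ).eval x = 0) :
    ev x (addL (smL a (mulL F2L F2L)) (addL (smL b (mulL F1L F2L)) (mulL F1L F1L))) = 0 := by
  rw [ev_addL, ev_addL, ev_smL, ev_smL, ev_mulL, ev_mulL, ev_mulL]
  rw [fS_eval, sub_eq_zero] at h
  simp only [ev] at hθ
  push_cast at hθ
  rw [h]
  linear_combination ev x F2L ^ 2 * hθ

lemma half {θ : k} (hθ : θ ^ 7 ≠ θ) (n : List ℕ) (i : ℕ) (hi : n.getD i 0 = 1) (S : Finset k)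
    (hS : ∀ x ∈ S, (fS θ).eval x = 0) (hn : ∀ x ∈ S, ev x n = 0) : 2 * S.card ≤ n.length - 1 := by
  classical
  have : ExpChar k 7 := ExpChar.prime (by norm_num)
  have hinj : Function.Injective (fun x : k => x ^ 7) := by
    have := (frobenius k 7).injective
    exact this
  have hd : Disjoint S (S.image (fun x => x ^ 7)) := by
    rw [Finset.disjoint_left]
    intro y hy hy'
    obtain ⟨x, hx, rfl⟩ := Finset.mem_image.1 hy'
    have h1 := hS _ hx
    have h2 := hS _ hy
    have h3 := F2_ne θ x h1
    rw [fS_eval, sub_eq_zero] at h1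
    simp only [fS_eval, ev_pow, h1, mul_pow] at h2
    rw [← sub_mul, mul_eq_zero, sub_eq_zero] at h2
    rcases h2 with h2 | h2
    · exact hθ h2
    · exact h3 (pow_eq_zero_iff (by norm_num) |>.1 h2)
  have h4 := card_roots_le n i hi (S ∪ S.image (fun x => x ^ 7)) (by
    intro x hx
    rcases Finset.mem_union.1 hx with hx | hx
    · exact hn x hx
    · obtain ⟨y, hy, rfl⟩ := Finset.mem_image.1 hx
      rw [ev_pow, hn y hy]; simp)
  rw [Finset.card_union_of_disjoint hd, Finset.card_image_of_injective _ hinj] at h4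
  omega
end num
end roots
section places
open Polynomial

lemma ev_monic {A : Type*} [CommRing A] [Nontrivial A] [CharP A 7] (l : List ℕ) (d : ℕ) (h : l.length = d + 1)
    (h1 : l.getD d 0 = 1) : (ev (X : A[X]) l).Monic ∧ (ev (X : A[X]) l).natDegree = d := by
  have hd := ev_natDegree (A := A) l
  rw [h, Nat.add_sub_cancel] at hd
  have hc := ev_coeff (A := A) l d
  rw [h1, Nat.cast_one] at hc
  refine ⟨monic_of_natDegree_le_of_coeff_eq_one d hd hc, natDegree_eq_of_le_of_coeff_ne_zero hd (by rw [hc]; exact one_ne_zero)⟩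

lemma ev_irr2 (a b : ℕ) (h : ∀ x : ZMod 7, ev x [a, b, 1] ≠ 0) : Irreducible (ev (X : (ZMod 7)[X]) [a, b, 1]) := by
  have hd := (ev_monic (A := ZMod 7) [a, b, 1] 2 rfl rfl).2
  apply irreducible_of_degree_le_three_of_not_isRoot (by rw [hd]; decide)
  intro x
  rw [IsRoot, ev_eval]
  exact h x

lemma ev_irr1 (a : ℕ) : Irreducible (ev (X : (ZMod 7)[X]) [a, 1]) := by
  have hd := (ev_monic (A := ZMod 7) [a, 1] 1 rfl rfl).2
  exact irreducible_of_degree_eq_one ((degree_eq_iff_natDegree_eq_of_pos one_pos).2 hd)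

/-- norm at `t = 4` -/
def N4 : List ℕ := [6, 6, 5, 3, 0, 6, 4, 0, 2, 3, 0, 0, 1]
/-- factor -/
def n11 : List ℕ := [6, 0, 5, 5, 2, 4, 0, 0, 2, 1, 6, 1]
/-- norm at `t = 1` -/
def N1 : List ℕ := [3, 5, 6, 6, 3, 5, 6, 0, 5, 6, 0, 0, 1]
/-- factor -/
def n4 : List ℕ := [4, 5, 6, 4, 1]
/-- factor -/
def n8 : List ℕ := [6, 6, 6, 0, 0, 6, 3, 3, 1]
/-- norm at the first quadratic place -/
def NA : List ℕ := [4, 1, 0, 6, 0, 5, 2, 0, 6, 2, 5, 2, 2, 3, 5, 5, 5, 4, 1, 0, 3, 5, 0, 0, 1]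
/-- factor -/
def nA4 : List ℕ := [2, 4, 4, 1, 1]
/-- factor -/
def n20 : List ℕ := [2, 0, 3, 3, 1, 0, 3, 6, 2, 1, 6, 4, 4, 3, 1, 1, 2, 1, 4, 6, 1]
/-- norm at the second quadratic place -/
def NB : List ℕ := [2, 0, 2, 0, 3, 3, 3, 2, 5, 2, 5, 6, 0, 6, 4, 4, 4, 6, 5, 0, 0, 2, 0, 0, 1]
/-- factor -/
def n6 : List ℕ := [3, 5, 1, 5, 4, 4, 1]
/-- factor -/
def n18 : List ℕ := [3, 2, 1, 2, 4, 4, 1, 5, 6, 4, 0, 0, 4, 6, 6, 0, 5, 3, 1]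

lemma split_ev {k : Type} [Field k] [CharP k 7] {x : k} {N a b : List ℕ} (hN : ev x N = 0)
    (h : eqL (mulL a b) N = true) : ev x a = 0 ∨ ev x b = 0 := by
  rw [← ev_eqL x h, ev_mulL] at hN
  exact mul_eq_zero.1 hN

lemma place4 : ∃ c : f.Gal, c ^ 11 = 1 ∧ ∃ a0 : Om, ∀ x, c • x = x ↔ x = a0 := by
  classical
  obtain ⟨k, _, _, θ, r, g, hθ, hg, hprod⟩ := place [3, 1] (ev_irr1 3) (ev_monic [3, 1] 1 rfl rfl).1 1
    (ev_monic [3, 1] 1 rfl rfl).2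
  have hN : ∀ x, ev (r x) N4 = 0 := fun x => by
    rw [ev_eqL (r x) (show eqL N4 (addL (smL 3 F2L) F1L) = true by decide +kernel)]
    exact norm1 3 hθ (place_root hprod x)
  have hr : Function.Injective r := place_inj hprod fun x =>
    ev_ne _ N4 WrL [0, 6, 4, 2, 4, 5, 0, 3, 3, 0, 0, 5] (hN x) (by decide +kernel)
  have h1 : g ^ 11 = 1 := gal_eq_one fun x => hr (by
    rw [place_pow hg, pw_eq (hN x) (by decide +kernel)])
  refine ⟨g, h1, ?_⟩
  have h2 : ∀ x, g • x = x → ev (r x) [1, 1] = 0 := by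
    intro x hx
    have h3 : r x ^ 7 ^ 1 = r x := by rw [← hg, hx]
    rcases split_ev (hN x) (show eqL (mulL [1, 1] n11) N4 = true by decide +kernel) with h | h
    · exact h
    · exact absurd h3 (pw_ne [5, 5, 5, 3, 6, 1, 6, 4, 3] h (by decide +kernel))
  have h3 : (Finset.univ.filter (fun x : Om => g • x = x)).card ≤ 1 := by
    rw [Finset.card_le_one]
    intro a ha b hb
    apply hr
    have e1 := h2 a (Finset.mem_filter.1 ha).2
    have e2 := h2 b (Finset.mem_filter.1 hb).2
    simp only [ev] at e1 e2
    linear_combination e1 - e2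
  have : Fact (Nat.Prime 11) := ⟨by norm_num⟩
  have h4 := fix_mod 11 g h1 (Finset.univ : Finset Om) (fun x _ => Finset.mem_univ _)
  rw [Finset.card_univ, Om_card] at h4
  have h5 : (Finset.univ.filter (fun x : Om => g • x = x)).card = 1 := by
    have := h4
    unfold Nat.ModEq at this
    omega
  obtain ⟨a0, ha⟩ := Finset.card_eq_one.1 h5
  refine ⟨a0, fun x => ?_⟩
  have := Finset.ext_iff.1 ha x
  simpa using this

lemma place1 : ∃ h : f.Gal, h ^ 8 = 1 ∧ h ^ 4 ≠ 1 ∧ (∀ x : Om, h • x ≠ x) ∧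
    ∃ x1 x2 x3 : Om, x1 ≠ x2 ∧ x1 ≠ x3 ∧ x2 ≠ x3 ∧ h ^ 4 • x1 = x1 ∧ h ^ 4 • x2 = x2 ∧ h ^ 4 • x3 = x3 := by
  classical
  obtain ⟨k, _, _, θ, r, g, hθ, hg, hprod⟩ := place [6, 1] (ev_irr1 6) (ev_monic [6, 1] 1 rfl rfl).1 1
    (ev_monic [6, 1] 1 rfl rfl).2
  have hN : ∀ x, ev (r x) N1 = 0 := fun x => by
    rw [ev_eqL (r x) (show eqL N1 (addL (smL 6 F2L) F1L) = true by decide +kernel)]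
    exact norm1 6 hθ (place_root hprod x)
  have hr : Function.Injective r := place_inj hprod fun x =>
    ev_ne _ N1 WrL [4, 6, 2, 4, 6, 0, 0, 4, 6, 5, 0, 6] (hN x) (by decide +kernel)
  have h1 : g ^ 8 = 1 := gal_eq_one fun x => hr (by
    rw [place_pow hg, pw_eq (hN x) (by decide +kernel)])
  have hsp := fun x => split_ev (hN x) (show eqL (mulL n4 n8) N1 = true by decide +kernel)
  have c4 : (Finset.univ.filter (fun x : Om => ev (r x) n4 = 0)).card ≤ 4 := by
    have := card_roots_le n4 4 rfl ((Finset.univ.filter (fun x : Om => ev (r x) n4 = 0)).image r) (by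
      intro x hx
      obtain ⟨y, hy, rfl⟩ := Finset.mem_image.1 hx
      exact (Finset.mem_filter.1 hy).2)
    rwa [Finset.card_image_of_injective _ hr] at this
  have c8 : (Finset.univ.filter (fun x : Om => ¬ ev (r x) n4 = 0)).card ≤ 8 := by
    have := card_roots_le n8 8 rfl ((Finset.univ.filter (fun x : Om => ¬ ev (r x) n4 = 0)).image r) (by
      intro x hx
      obtain ⟨y, hy, rfl⟩ := Finset.mem_image.1 hx
      exact (hsp y).resolve_left (Finset.mem_filter.1 hy).2)
    rwa [Finset.card_image_of_injective _ hr] at this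
  have hs := Finset.card_filter_add_card_filter_not (s := (Finset.univ : Finset Om)) (fun x : Om => ev (r x) n4 = 0)
  rw [Finset.card_univ, Om_card] at hs
  refine ⟨g, h1, ?_, ?_, ?_⟩
  · intro h4
    obtain ⟨y, hy⟩ := Finset.card_pos.1 (show 0 < (Finset.univ.filter (fun x : Om => ¬ ev (r x) n4 = 0)).card by omega)
    have h8 := (hsp y).resolve_left (Finset.mem_filter.1 hy).2
    have h5 : r y ^ 7 ^ (1 * 4) = r y := by rw [← place_pow hg, h4, one_smul]
    exact pw_ne [4, 4, 6, 4, 0, 4, 6, 2] h8 (by decide +kernel) h5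
  · intro x hx
    have h3 : r x ^ 7 ^ 1 = r x := by rw [← hg, hx]
    exact pw_ne [3, 0, 0, 4, 3, 5, 6, 2, 3, 3, 5, 2] (hN x) (by decide +kernel) h3
  · obtain ⟨x1, x2, x3, a1, a2, a3, b1, b2, b3⟩ := Finset.two_lt_card_iff.1
      (show 2 < (Finset.univ.filter (fun x : Om => ev (r x) n4 = 0)).card by omega)
    have hf : ∀ x ∈ (Finset.univ.filter (fun x : Om => ev (r x) n4 = 0)), g ^ 4 • x = x := by
      intro x hx
      apply hr
      rw [place_pow hg, pw_eq (Finset.mem_filter.1 hx).2 (by decide +kernel)]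
    exact ⟨x1, x2, x3, b1, b2, b3, hf _ a1, hf _ a2, hf _ a3⟩

lemma placeA : ∃ u : f.Gal, u ^ 5 = 1 ∧ ∃ y1 y2 : Om, y1 ≠ y2 ∧ ∀ x, u • x = x ↔ x = y1 ∨ x = y2 := by
  classical
  obtain ⟨k, _, _, θ, r, g, hθ, hg, hprod⟩ := place [3, 5, 1] (ev_irr2 3 5 (by decide))
    (ev_monic [3, 5, 1] 2 rfl rfl).1 2 (ev_monic [3, 5, 1] 2 rfl rfl).2
  have hN : ∀ x, ev (r x) NA = 0 := fun x => by
    rw [ev_eqL (r x) (show eqL NA (addL (smL 3 (mulL F2L F2L)) (addL (smL 5 (mulL F1L F2L)) (mulL F1L F1L))) = true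
      by decide +kernel)]
    exact norm2 3 5 hθ (place_root hprod x)
  have hr : Function.Injective r := place_inj hprod fun x =>
    ev_ne _ NA WrL [4, 1, 2, 3, 4, 5, 1, 2, 5, 6, 3, 5, 0, 0, 0, 3, 3, 6, 5, 4, 3, 3, 1, 1] (hN x) (by decide +kernel)
  have h1 : g ^ 5 = 1 := gal_eq_one fun x => hr (by
    rw [place_pow hg, pw_eq (hN x) (by decide +kernel)])
  have hθ7 : θ ^ 7 ≠ θ := by
    have := pw_ne (m := 1) [5, 2] hθ (by decide +kernel)
    simpa using this
  refine ⟨g, h1, ?_⟩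
  have h3 : (Finset.univ.filter (fun x : Om => g • x = x)).card ≤ 2 := by
    have h2 := half hθ7 nA4 4 rfl ((Finset.univ.filter (fun x : Om => g • x = x)).image r) (by
      intro x hx
      obtain ⟨y, hy, rfl⟩ := Finset.mem_image.1 hx
      exact place_root hprod y) (by
      intro x hx
      obtain ⟨y, hy, rfl⟩ := Finset.mem_image.1 hx
      have hy2 := (Finset.mem_filter.1 hy).2
      have h3 : r y ^ 7 ^ 2 = r y := by rw [← hg, hy2]
      rcases split_ev (hN y) (show eqL (mulL nA4 n20) NA = true by decide +kernel) with h | h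
      · exact h
      · exact absurd h3 (pw_ne [3, 5, 6, 1, 3, 0, 5, 2, 6, 0, 1, 6, 3, 4, 1, 2, 5, 5, 2, 6] h (by decide +kernel)))
    rw [Finset.card_image_of_injective _ hr] at h2
    simp only [nA4, List.length] at h2
    omega
  have : Fact (Nat.Prime 5) := ⟨by norm_num⟩
  have h4 := fix_mod 5 g h1 (Finset.univ : Finset Om) (fun x _ => Finset.mem_univ _)
  rw [Finset.card_univ, Om_card] at h4
  have h5 : (Finset.univ.filter (fun x : Om => g • x = x)).card = 2 := by
    have := h4
    unfold Nat.ModEq at this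
    omega
  obtain ⟨y1, y2, hy, ha⟩ := Finset.card_eq_two.1 h5
  refine ⟨y1, y2, hy, fun x => ?_⟩
  have := Finset.ext_iff.1 ha x
  simpa using this

lemma placeB : ∃ τ : f.Gal, τ ^ 3 = 1 ∧ ∃ z1 z2 z3 : Om, z1 ≠ z2 ∧ z1 ≠ z3 ∧ z2 ≠ z3 ∧
    ∀ x, τ • x = x ↔ x = z1 ∨ x = z2 ∨ x = z3 := by
  classical
  obtain ⟨k, _, _, θ, r, g, hθ, hg, hprod⟩ := place [2, 2, 1] (ev_irr2 2 2 (by decide))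
    (ev_monic [2, 2, 1] 2 rfl rfl).1 2 (ev_monic [2, 2, 1] 2 rfl rfl).2
  have hN : ∀ x, ev (r x) NB = 0 := fun x => by
    rw [ev_eqL (r x) (show eqL NB (addL (smL 2 (mulL F2L F2L)) (addL (smL 2 (mulL F1L F2L)) (mulL F1L F1L))) = true
      by decide +kernel)]
    exact norm2 2 2 hθ (place_root hprod x)
  have hr : Function.Injective r := place_inj hprod fun x =>
    ev_ne _ NB WrL [6, 2, 2, 0, 3, 2, 3, 2, 0, 2, 3, 0, 4, 6, 6, 4, 3, 3, 5, 2, 4, 2, 2, 1] (hN x) (by decide +kernel)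
  have h1 : (g ^ 2) ^ 3 = 1 := by
    rw [← pow_mul]
    exact gal_eq_one fun x => hr (by rw [place_pow hg, pw_eq (hN x) (by decide +kernel)])
  have hθ7 : θ ^ 7 ≠ θ := by
    have := pw_ne (m := 1) [4, 4] hθ (by decide +kernel)
    simpa using this
  have hsp := fun x => split_ev (hN x) (show eqL (mulL n6 n18) NB = true by decide +kernel)
  have hfix : ∀ x, g ^ 2 • x = x ↔ ev (r x) n6 = 0 := by
    intro x
    constructor
    · intro hx
      have h3 : r x ^ 7 ^ (2 * 2) = r x := by rw [← place_pow hg, hx]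
      rcases hsp x with h | h
      · exact h
      · exact absurd h3 (pw_ne [3, 3, 6, 5, 1, 1, 0, 4, 1, 1, 3, 0, 6, 5, 1, 0, 2, 5] h (by decide +kernel))
    · intro hx
      apply hr
      rw [place_pow hg, pw_eq hx (by decide +kernel)]
  refine ⟨g ^ 2, h1, ?_⟩
  have h3 : (Finset.univ.filter (fun x : Om => g ^ 2 • x = x)).card ≤ 3 := by
    have h2 := half hθ7 n6 6 rfl ((Finset.univ.filter (fun x : Om => g ^ 2 • x = x)).image r) (by
      intro x hx
      obtain ⟨y, hy, rfl⟩ := Finset.mem_image.1 hx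
      exact place_root hprod y) (by
      intro x hx
      obtain ⟨y, hy, rfl⟩ := Finset.mem_image.1 hx
      exact (hfix y).1 (Finset.mem_filter.1 hy).2)
    rw [Finset.card_image_of_injective _ hr] at h2
    simp only [n6, List.length] at h2
    omega
  have h4 : (Finset.univ.filter (fun x : Om => ¬ g ^ 2 • x = x)).card ≤ 9 := by
    have h2 := half hθ7 n18 18 rfl ((Finset.univ.filter (fun x : Om => ¬ g ^ 2 • x = x)).image r) (by
      intro x hx
      obtain ⟨y, hy, rfl⟩ := Finset.mem_image.1 hx
      exact place_root hprod y) (by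
      intro x hx
      obtain ⟨y, hy, rfl⟩ := Finset.mem_image.1 hx
      exact (hsp y).resolve_left (fun h => (Finset.mem_filter.1 hy).2 ((hfix y).2 h)))
    rw [Finset.card_image_of_injective _ hr] at h2
    simp only [n18, List.length] at h2
    omega
  have hs := Finset.card_filter_add_card_filter_not (s := (Finset.univ : Finset Om)) (fun x : Om => g ^ 2 • x = x)
  rw [Finset.card_univ, Om_card] at hs
  obtain ⟨z1, z2, z3, a1, a2, a3, ha⟩ := Finset.card_eq_three.1
    (show (Finset.univ.filter (fun x : Om => g ^ 2 • x = x)).card = 3 by omega)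
  refine ⟨z1, z2, z3, a1, a2, a3, fun x => ?_⟩
  have := Finset.ext_iff.1 ha x
  simpa using this
end places
section blocks
open Polynomial

/-- the elliptic curve -/
def cL : List ℕ := [2, 6, 5, 1]
/-- numerator of the covering, first component -/
def pa : List ℕ := [1, 0, 1, 5, 5, 0, 1, 2, 3, 4, 1, 5]
/-- numerator of the covering, second component -/
def pb : List ℕ := [3, 4, 6, 0, 3, 2, 0, 4, 2, 3, 1]
/-- denominator of the covering, first component -/
def qa : List ℕ := [3, 5, 6, 2, 5, 3, 4, 0, 0, 6, 6, 1]
/-- denominator of the covering, second component -/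
def qb : List ℕ := [2, 2, 2, 6, 5, 1, 6, 5, 3, 1]
/-- norm coefficient -/
def m0 : List ℕ := [6, 6, 6, 2, 5, 1, 0, 0, 5, 1, 1, 4, 3, 5, 0, 2, 1, 1, 5, 6, 1, 3, 6]
/-- norm coefficient -/
def m1 : List ℕ := [6, 0, 2, 1, 5, 0, 5, 3, 5, 1, 0, 4, 1, 5, 4, 3, 0, 3, 2, 2, 5, 6]
/-- norm coefficient -/
def m2 : List ℕ := [5, 2, 3, 5, 4, 5, 5, 0, 5, 1, 1, 2, 2, 2, 1, 1, 3, 4, 6, 6, 1, 1]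
/-- leading coefficient -/
def wP : List ℕ × List ℕ := ([5,5,3,0,1,4,5,0,6,6,6,4],[5,6,6,1,1,3,4,3,3,6,1])
/-- its multiple by `t` -/
def wQ : List ℕ × List ℕ := ([4,6,3,4,6,3,3,4,5,1,3,6,1],[4,5,3,2,0,0,0,4,3,6,1])
/-- first factor -/
def lA : List (List ℕ × List ℕ) := [([2,2,3,3,3,1,1],[3,2,5,1,1]), ([3,6,3,5,0,2,2],[3,2,6,4,3]),
  ([3,4,4,2,5,0,6],[3,1,6]), ([6,0,1,4,4,0,6],[3,6,6,2,5]), ([2,1,0,4,6,4],[5,1,5,3,5]),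
  ([2,3,1,5,4,6],[6,3,1,1]), ([4,6,1,4,4,3],[0,0,4,2,1])]
/-- second factor -/
def lB : List (List ℕ × List ℕ) := [([1,6,1,1,6,4,1],[2,0,5,4,2]), ([2,2,3,5,4,2,3],[6,3,5,2,2]),
  ([6,4,4,6,5,0,4],[6,0,1,5,5]), ([2,6,5,2,6,5,2],[3,5,0,3,2]), ([2,1,4,3,5,2,2],[3,4,4,5,6]),
  ([0,4,6,6,1,4],[1,3,6,5,1]), ([3,2,5,2,3,1,1],[3,4,4,6,1])]

/-- product on the curve -/
def mulP (p q : List ℕ × List ℕ) : List ℕ × List ℕ :=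
  (addL (mulL p.1 q.1) (mulL cL (mulL p.2 q.2)), addL (mulL p.1 q.2) (mulL p.2 q.1))
/-- sum on the curve -/
def addP (p q : List ℕ × List ℕ) : List ℕ × List ℕ := (addL p.1 q.1, addL p.2 q.2)
/-- scaling -/
def smP (a : ℕ) (p : List ℕ × List ℕ) : List ℕ × List ℕ := (smL a p.1, smL a p.2)
/-- addition of lists -/
def addPP : List (List ℕ × List ℕ) → List (List ℕ × List ℕ) → List (List ℕ × List ℕ)
  | [], l => l
  | a :: l, [] => a :: l
  | a :: l, b :: m => addP a b :: addPP l m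
/-- multiplication of lists -/
def mulPP : List (List ℕ × List ℕ) → List (List ℕ × List ℕ) → List (List ℕ × List ℕ)
  | [], _ => []
  | a :: l, m => addPP (m.map (mulP a)) (([], []) :: mulPP l m)
/-- equality of lists -/
def eqPP : List (List ℕ × List ℕ) → List (List ℕ × List ℕ) → Bool
  | [], [] => true
  | a :: l, b :: m => eqL a.1 b.1 && eqL a.2 b.2 && eqPP l m
  | [], _ :: _ => false
  | _ :: _, [] => false

section gen
variable {A : Type*} [CommRing A]
/-- evaluation on the curve -/
def evp (u v : A) (p : List ℕ × List ℕ) : A := ev u p.1 + v * ev u p.2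
/-- evaluation of a polynomial on the curve -/
def ev2 (x u v : A) : List (List ℕ × List ℕ) → A
  | [] => 0
  | p :: l => evp u v p + x * ev2 x u v l

lemma evp_map {B : Type*} [CommRing B] (φ : A →+* B) (u v : A) (p : List ℕ × List ℕ) :
    φ (evp u v p) = evp (φ u) (φ v) p := by
  simp [evp, ev_map]

lemma ev2_map {B : Type*} [CommRing B] (φ : A →+* B) (x u v : A) (l : List (List ℕ × List ℕ)) :
    φ (ev2 x u v l) = ev2 (φ x) (φ u) (φ v) l := by
  induction l with
  | nil => simp [ev2]
  | cons p l ih => simp [ev2, ih, evp_map]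

/-- the polynomial -/
noncomputable def pol (u v : A) (l : List (List ℕ × List ℕ)) : A[X] := ev2 X (C u) (C v) l

lemma pol_eval (x u v : A) (l : List (List ℕ × List ℕ)) : (pol u v l).eval x = ev2 x u v l := by
  have := ev2_map (evalRingHom x) (X : A[X]) (C u) (C v) l
  simpa [pol] using this

lemma pol_coeff (u v : A) (l : List (List ℕ × List ℕ)) (i : ℕ) :
    (pol u v l).coeff i = evp u v (l.getD i ([], [])) := by
  induction l generalizing i with
  | nil => simp [pol, ev2, evp, ev]
  | cons p l ih =>
    have h : pol u v (p :: l) = C (evp u v p) + X * pol u v l := by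
      simp only [pol, ev2, evp_map]
    rw [h]
    cases i with
    | zero => simp
    | succ i => simp [ih]

variable [CharP A 7]
lemma evp_mul {u v : A} (h : v ^ 2 = ev u cL) (p q : List ℕ × List ℕ) :
    evp u v (mulP p q) = evp u v p * evp u v q := by
  simp only [evp, mulP, ev_addL, ev_mulL, ← h]; ring

lemma evp_add (u v : A) (p q : List ℕ × List ℕ) : evp u v (addP p q) = evp u v p + evp u v q := by
  simp only [evp, addP, ev_addL]; ring

lemma evp_sm (u v : A) (a : ℕ) (p : List ℕ × List ℕ) : evp u v (smP a p) = a * evp u v p := by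
  simp only [evp, smP, ev_smL]; ring

lemma ev2_add (x u v : A) (l m : List (List ℕ × List ℕ)) :
    ev2 x u v (addPP l m) = ev2 x u v l + ev2 x u v m := by
  induction l generalizing m with
  | nil => simp [addPP, ev2]
  | cons a l ih =>
    cases m with
    | nil => simp [addPP, ev2]
    | cons b m => simp only [addPP, ev2, ih, evp_add]; ring

lemma ev2_map_mul {u v : A} (h : v ^ 2 = ev u cL) (x : A) (p : List ℕ × List ℕ) (m : List (List ℕ × List ℕ)) :
    ev2 x u v (m.map (mulP p)) = evp u v p * ev2 x u v m := by
  induction m with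
  | nil => simp [ev2]
  | cons a m ih => simp only [List.map_cons, ev2, ih, evp_mul h]; ring

lemma ev2_mul {u v : A} (h : v ^ 2 = ev u cL) (x : A) (l m : List (List ℕ × List ℕ)) :
    ev2 x u v (mulPP l m) = ev2 x u v l * ev2 x u v m := by
  induction l with
  | nil => simp [mulPP, ev2]
  | cons a l ih =>
    simp only [mulPP, ev2, ev2_add, ev2_map_mul h, ih]
    simp only [evp, ev]; ring

lemma ev2_const (x u v : A) (p : List ℕ × List ℕ) (l : List ℕ) :
    ev2 x u v (l.map (fun a => smP a p)) = evp u v p * ev x l := by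
  induction l with
  | nil => simp [ev2, ev]
  | cons a l ih => simp only [List.map_cons, ev2, ev, ih, evp_sm]; ring

lemma ev2_eq (x u v : A) : ∀ (l m : List (List ℕ × List ℕ)), eqPP l m = true → ev2 x u v l = ev2 x u v m
  | [], [], _ => rfl
  | a :: l, b :: m, h => by
    simp only [eqPP, Bool.and_eq_true] at h
    simp only [ev2, evp, ev_eqL u h.1.1, ev_eqL u h.1.2, ev2_eq x u v l m h.2]
  | [], _ :: _, h => by simp [eqPP] at h
  | _ :: _, [], h => by simp [eqPP] at h

end gen

lemma big_cert : eqPP (mulPP lA lB) (addPP (F1L.map (fun a => smP a wP)) (F2L.map (fun a => smP a (smP 6 wQ)))) = true := by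
  decide +kernel

lemma w_cert : eqL (mulP wQ (qa, qb)).1 (mulP wP (pa, pb)).1 = true ∧
    eqL (mulP wQ (qa, qb)).2 (mulP wP (pa, pb)).2 = true := by
  constructor <;> decide +kernel

section field
variable {M : Type*} [Field M] [Algebra (ZMod 7) M] [Algebra (RatFunc (ZMod 7)) M]
  [IsScalarTower (ZMod 7) (RatFunc (ZMod 7)) M] [CharP M 7]

/-- image of `t` -/
noncomputable def tM (M : Type*) [Field M] [Algebra (RatFunc (ZMod 7)) M] : M := algebraMap (RatFunc (ZMod 7)) M t

/-- equation satisfied by the parameter -/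
def Par (u : M) : Prop := ev u m0 + tM M * ev u m1 + tM M ^ 2 * ev u m2 = 0

lemma two_ne : (2 : M) ≠ 0 := by
  have h : ((2 : ℕ) : M) ≠ 0 := by
    rw [Ne, CharP.cast_eq_zero_iff M 7]; norm_num
  exact_mod_cast h

lemma par_trans {u : M} (hu : Par u) : ¬ IsAlgebraic (ZMod 7) u := by
  intro ha
  unfold Par at hu
  apply t_trans (M := M)
  change IsAlgebraic (ZMod 7) (tM M)
  have a0 := ev_alg ha m0
  have a1 := ev_alg ha m1
  have a2 := ev_alg ha m2
  by_cases h2 : ev u m2 = 0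
  · have h0 := ev_ne u m2 m0 [5, 4, 6, 6, 0, 6, 6, 0, 2, 1, 0, 0, 2, 5, 2, 3, 0, 0, 4, 4, 3] h2 (by decide +kernel)
    rw [h2] at hu
    have h1 : ev u m1 ≠ 0 := by
      intro h1
      rw [h1] at hu
      apply h0
      linear_combination hu
    have e : tM M = - (ev u m0 * (ev u m1)⁻¹) := by
      field_simp
      linear_combination hu
    rw [e]
    exact (a0.mul a1.inv).neg
  · have hs : IsAlgebraic (ZMod 7) (2 * ev u m2 * tM M + ev u m1) := by
      apply IsAlgebraic.of_pow (n := 2) (by norm_num)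
      have e : (2 * ev u m2 * tM M + ev u m1) ^ 2 = ev u m1 * ev u m1 - ((4 : ℕ) : M) * (ev u m0 * ev u m2) := by
        push_cast
        linear_combination 4 * ev u m2 * hu
      rw [e]
      exact (a1.mul a1).sub ((isAlgebraic_natCast 4).mul (a0.mul a2))
    have h2' := two_ne (M := M)
    have e : tM M = ((2 * ev u m2 * tM M + ev u m1) - ev u m1) * (((2 : ℕ) : M) * ev u m2)⁻¹ := by
      push_cast
      field_simp
      ring
    rw [e]
    exact (hs.sub a1).mul ((isAlgebraic_natCast 2).mul a2).inv

lemma par_ne {u : M} (hu : Par u) {l : List ℕ} (i : ℕ) (hi : ((l.getD i 0 : ℕ) : ZMod 7) ≠ 0) : ev u l ≠ 0 :=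
  fun h => par_trans hu (alg_of_ev i hi h)

/-- second coordinate -/
noncomputable def vv (u : M) : M := - (ev u pa - tM M * ev u qa) / (ev u pb - tM M * ev u qb)

lemma par_norm {u : M} (hu : Par u) :
    (ev u pa - tM M * ev u qa) ^ 2 = ev u cL * (ev u pb - tM M * ev u qb) ^ 2 := by
  have e0 := ev_eqL u (show eqL (addL (mulL pa pa) (smL 6 (mulL cL (mulL pb pb)))) (mulL [3, 1] m0) = true by decide +kernel)
  have e1 := ev_eqL u (show eqL (smL 5 (addL (mulL pa qa) (smL 6 (mulL cL (mulL pb qb))))) (mulL [3, 1] m1) = true by decide +kernel)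
  have e2 := ev_eqL u (show eqL (addL (mulL qa qa) (smL 6 (mulL cL (mulL qb qb)))) (mulL [3, 1] m2) = true by decide +kernel)
  simp only [ev_addL, ev_mulL, ev_smL] at e0 e1 e2
  unfold Par at hu
  have h7 : (7 : M) = 0 := by exact_mod_cast CharP.cast_eq_zero M 7
  push_cast at e0 e1 e2
  linear_combination e0 + tM M * e1 + tM M ^ 2 * e2 + ev u [3, 1] * hu +
    (-ev u cL * ev u pb ^ 2 - tM M * ev u pa * ev u qa - 4 * tM M * ev u cL * ev u pb * ev u qb
      - tM M ^ 2 * ev u cL * ev u qb ^ 2) * h7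

lemma par_den {u : M} (hu : Par u) : ev u pb - tM M * ev u qb ≠ 0 := by
  intro h
  have h1 := par_norm hu
  rw [h] at h1
  have h2 : ev u pa - tM M * ev u qa = 0 := by
    apply pow_eq_zero_iff (n := 2) (by norm_num) |>.1
    rw [h1]; ring
  have h3 : ev u (addL (mulL pa qb) (smL 6 (mulL pb qa))) = 0 := by
    simp only [ev_addL, ev_mulL, ev_smL]
    have h7 : (7 : M) = 0 := by exact_mod_cast CharP.cast_eq_zero M 7
    push_cast
    linear_combination ev u qb * h2 - ev u qa * h + ev u pb * ev u qa * h7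
  exact par_ne hu 1 (by decide +kernel) h3

lemma par_curve {u : M} (hu : Par u) : vv u ^ 2 = ev u cL := by
  have h1 := par_norm hu
  have h2 := par_den hu
  rw [vv, div_pow, neg_sq, h1]
  field_simp

lemma par_t {u : M} (hu : Par u) : evp u (vv u) (pa, pb) = tM M * evp u (vv u) (qa, qb) := by
  have h2 := par_den hu
  have h3 : vv u * (ev u pb - tM M * ev u qb) = - (ev u pa - tM M * ev u qa) := by
    rw [vv, div_mul_cancel₀ _ h2]
  simp only [evp]
  linear_combination h3

lemma par_evp_ne {u : M} (hu : Par u) (p : List ℕ × List ℕ) (i : ℕ)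
    (hi : (((addL (mulL p.1 p.1) (smL 6 (mulL cL (mulL p.2 p.2)))).getD i 0 : ℕ) : ZMod 7) ≠ 0) :
    evp u (vv u) p ≠ 0 := by
  intro h
  apply par_ne hu i hi
  simp only [ev_addL, ev_mulL, ev_smL]
  have h7 : (7 : M) = 0 := by exact_mod_cast CharP.cast_eq_zero M 7
  have hc := par_curve hu
  simp only [evp] at h
  push_cast
  linear_combination (ev u p.1 - vv u * ev u p.2) * h + ev u p.2 ^ 2 * hc + ev u cL * ev u p.2 ^ 2 * h7

lemma par_fac {u : M} (hu : Par u) (x : M) :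
    ev2 x u (vv u) lA * ev2 x u (vv u) lB = evp u (vv u) wP * (fS (tM M)).eval x := by
  have hc := par_curve hu
  rw [← ev2_mul hc, ev2_eq x u (vv u) _ _ big_cert, ev2_add, ev2_const, ev2_const, evp_sm, fS_eval]
  have h1 : evp u (vv u) (mulP wQ (qa, qb)) = evp u (vv u) (mulP wP (pa, pb)) := by
    unfold evp
    rw [ev_eqL u w_cert.1, ev_eqL u w_cert.2]
  rw [evp_mul hc, evp_mul hc, par_t hu] at h1
  have hq := par_evp_ne hu (qa, qb) 0 (by decide +kernel)
  have h2 : evp u (vv u) wQ = evp u (vv u) wP * tM M := by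
    apply mul_right_cancel₀ hq
    rw [h1]; ring
  rw [h2]
  have h7 : (7 : M) = 0 := by exact_mod_cast CharP.cast_eq_zero M 7
  push_cast
  linear_combination evp u (vv u) wP * tM M * ev x F2L * h7

end field
end blocks
section final
open Polynomial

/-- the big field -/
abbrev MM : Type := AlgebraicClosure f.SplittingField

instance : CharP MM 7 := charP_of_injective_algebraMap (algebraMap (ZMod 7) MM).injective 7

/-- the block attached to a parameter -/
noncomputable def blk (u : MM) : Finset Om := by
  classical
  exact Finset.univ.filter (fun x : Om => ev2 (algebraMap f.SplittingField MM x) u (vv u) lA = 0)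

lemma mem_blk (u : MM) (x : Om) : x ∈ blk u ↔ ev2 (algebraMap f.SplittingField MM x) u (vv u) lA = 0 := by
  classical
  unfold blk
  simp

lemma om_eval (x : Om) : (fS (tM MM)).eval (algebraMap f.SplittingField MM x) = 0 := by
  have h : aeval (x : f.SplittingField) f = 0 := aeval_eq_zero_of_mem_rootSet x.2
  have h2 : aeval (algebraMap f.SplittingField MM x) f = 0 := by
    rw [aeval_algebraMap_apply, h, map_zero]
  have h3 : f.map (algebraMap (RatFunc (ZMod 7)) MM) = fS (tM MM) :=
    (congrArg (Polynomial.map (algebraMap (RatFunc (ZMod 7)) MM)) f_eq).trans (fS_map _ _)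
  rwa [aeval_def, ← eval_map, h3] at h2

lemma cnt (l : List (List ℕ × List ℕ)) (hl : l.length = 7) (u v : MM) (h6 : evp u v (l.getD 6 ([], [])) ≠ 0)
    (S : Finset Om) (hS : ∀ x ∈ S, ev2 (algebraMap f.SplittingField MM x) u v l = 0) : S.card ≤ 6 := by
  classical
  have h0 : pol u v l ≠ 0 := by
    intro h0
    rw [← pol_coeff, h0] at h6
    exact h6 (coeff_zero _)
  have hj : Function.Injective (fun x : Om => algebraMap f.SplittingField MM x) :=
    (algebraMap f.SplittingField MM).injective.comp Subtype.val_injective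
  have hsub : S.image (fun x : Om => algebraMap f.SplittingField MM x) ⊆ (pol u v l).roots.toFinset := by
    intro y hy
    obtain ⟨x, hx, rfl⟩ := Finset.mem_image.1 hy
    rw [Multiset.mem_toFinset, mem_roots h0, IsRoot, pol_eval]
    exact hS x hx
  have hd : (pol u v l).natDegree ≤ 6 := by
    rw [natDegree_le_iff_coeff_eq_zero]
    intro N hN
    rw [pol_coeff, List.getD_eq_default _ _ (by omega)]
    simp [evp, ev]
  rw [← Finset.card_image_of_injective S hj]
  calc _ ≤ _ := Finset.card_le_card hsub
    _ ≤ _ := Multiset.toFinset_card_le _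
    _ ≤ _ := card_roots' _
    _ ≤ _ := hd

lemma blk_card {u : MM} (hu : Par u) : (blk u).card = 6 := by
  classical
  have hA := cnt lA rfl u (vv u) (par_evp_ne hu _ 0 (by decide +kernel)) (blk u) (fun x hx => (mem_blk u x).1 hx)
  have hB := cnt lB rfl u (vv u) (par_evp_ne hu _ 0 (by decide +kernel)) (blk u)ᶜ (fun x hx => by
    have h1 := par_fac hu (algebraMap f.SplittingField MM x)
    rw [om_eval, mul_zero, mul_eq_zero] at h1
    rw [Finset.mem_compl, mem_blk] at hx
    exact h1.resolve_left hx)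
  have := Finset.card_add_card_compl (blk u)
  rw [Om_card] at this
  omega

/-- parameter polynomial -/
noncomputable def parP : MM[X] := ev X m0 + C (tM MM) * ev X m1 + C (tM MM ^ 2) * ev X m2

lemma parP_eval (u : MM) : parP.eval u = 0 ↔ Par u := by
  simp [parP, Par, ev_eval]

lemma parP_coeff (i : ℕ) : parP.coeff i = ((m0.getD i 0 : ℕ) : MM) + tM MM * ((m1.getD i 0 : ℕ) : MM)
    + tM MM ^ 2 * ((m2.getD i 0 : ℕ) : MM) := by
  simp only [parP, coeff_add, coeff_C_mul, ev_coeff]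

lemma parP_deg : parP.natDegree = 22 := by
  apply natDegree_eq_of_le_of_coeff_ne_zero
  · rw [natDegree_le_iff_coeff_eq_zero]
    intro N hN
    rw [parP_coeff, List.getD_eq_default _ _ (by simp [m0]; omega), List.getD_eq_default _ _ (by simp [m1]; omega),
      List.getD_eq_default _ _ (by simp [m2]; omega)]
    simp
  · have h : parP.coeff 22 = ((6 : ℕ) : MM) := by
      rw [parP_coeff]; simp [m0, m1, m2]
    rw [h, Ne, CharP.cast_eq_zero_iff MM 7]
    norm_num

lemma parP_ne : parP ≠ 0 := by
  intro h
  have := parP_deg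
  rw [h] at this
  simp at this

/-- the blocks -/
noncomputable def BB : Finset (Finset Om) := by
  classical
  exact parP.roots.toFinset.image blk

lemma mem_BB (b : Finset Om) : b ∈ BB ↔ ∃ u, Par u ∧ blk u = b := by
  classical
  unfold BB
  simp only [Finset.mem_image, Multiset.mem_toFinset, mem_roots parP_ne, IsRoot, parP_eval]

lemma BB_card : BB.card ≤ 22 := by
  classical
  unfold BB
  calc _ ≤ _ := Finset.card_image_le
    _ ≤ _ := Multiset.toFinset_card_le _
    _ ≤ _ := card_roots' _
    _ = 22 := parP_deg

lemma BB_ne : BB.Nonempty := by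
  obtain ⟨u, hu⟩ := IsAlgClosed.exists_root parP (by
    rw [degree_eq_natDegree parP_ne, parP_deg]; norm_num)
  exact ⟨blk u, (mem_BB _).2 ⟨u, (parP_eval u).1 hu, rfl⟩⟩

lemma blk_smul (g : f.Gal) (u : MM) (hu : Par u) :
    ∃ w : MM, Par w ∧ ∀ x : Om, x ∈ blk u ↔ g • x ∈ blk w := by
  let σ : MM ≃ₐ[RatFunc (ZMod 7)] MM := AlgEquiv.liftNormal (F := RatFunc (ZMod 7)) (K₁ := f.SplittingField)
    (K₂ := f.SplittingField) g MM
  have hσ : ∀ y : f.SplittingField, σ (algebraMap f.SplittingField MM y) = algebraMap f.SplittingField MM (g y) :=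
    fun y => AlgEquiv.liftNormal_commutes _ _ y
  have ht : σ (tM MM) = tM MM := σ.commutes t
  have hev : ∀ (y : MM) l, σ (ev y l) = ev (σ y) l := fun y l => ev_map (σ : MM →+* MM) y l
  have hev2 : ∀ (x y z : MM) l, σ (ev2 x y z l) = ev2 (σ x) (σ y) (σ z) l := fun x y z l => ev2_map (σ : MM →+* MM) x y z l
  have hv : σ (vv u) = vv (σ u) := by
    simp only [vv, map_div₀, map_neg, map_sub, map_mul, hev, ht]
  refine ⟨σ u, ?_, ?_⟩
  · have := congrArg σ hu
    unfold Par
    simpa only [map_add, map_mul, map_pow, hev, ht, map_zero] using this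
  · intro x
    rw [mem_blk, mem_blk, Om_smul, ← hσ, ← hv, ← hev2]
    exact (map_eq_zero_iff σ σ.injective).symm

lemma BB_inv [DecidableEq Om] (g : f.Gal) (b : Finset Om) (hb : b ∈ BB) : b.image (g • ·) ∈ BB := by
  obtain ⟨u, hu, rfl⟩ := (mem_BB b).1 hb
  obtain ⟨w, hw, h⟩ := blk_smul g u hu
  refine (mem_BB _).2 ⟨w, hw, ?_⟩
  ext y
  rw [Finset.mem_image]
  constructor
  · intro hy
    refine ⟨g⁻¹ • y, (h _).2 ?_, ?_⟩
    · rwa [smul_inv_smul]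
    · exact smul_inv_smul g y
  · rintro ⟨x, hx, rfl⟩
    exact (h x).1 hx

instance : Finite f.Gal := inferInstance

theorem main : IsSimpleGroup f.Gal ∧ Nat.card f.Gal = 7920 := by
  classical
  obtain ⟨c, hc, a0, hca⟩ := place4
  obtain ⟨h, hh8, hh4, hh0, x1, x2, x3, e1, e2, e3, i1, i2, i3⟩ := place1
  obtain ⟨u, hu, y1, y2, hy, hu'⟩ := placeA
  obtain ⟨τ, hτ, z1, z2, z3, k1, k2, k3, hτ'⟩ := placeB
  exact group_main Om_card c h u τ hc a0 hca hh8 hh4 hh0 x1 x2 x3 e1 e2 e3 i1 i2 i3 hu y1 y2 hy hu'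
    hτ z1 z2 z3 k1 k2 k3 hτ' BB (fun g b hb => BB_inv g b hb)
    (fun b hb => by obtain ⟨w, hw, rfl⟩ := (mem_BB b).1 hb; exact blk_card hw) BB_ne BB_card
end final
end M11

theorem m11_mod7 : f.natDegree = 12 ∧ IsSimpleGroup f.Gal ∧ Nat.card f.Gal = 7920 := by
  refine ⟨?_, M11.main⟩
  rw [M11.f_eq]
  exact M11.fS_natDegree t
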